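/- For an augmented unital associative dg algebra A over R with augmentation ideal Ā, every multiplication on the normalized bar construction B̄A (a morphism of dg coalgebras with 1 as two-sided unit) extends canonically to a multiplication on BA whose twisting cochain E is normalized: E([1],1) = E(1,[1]) = 1, E(a,b) = 0 if the total bar length k+l > 1 and some entry a_i or b_j equals 1 ∈ A, and E(a,b) ∈ Ā whenever k+l > 1. Conversely, every normalized twisting cochain E : BA⊗BA → A comes from a unique multiplication on B̄A; thus normalized twisting cochains correspond bijectively to multiplications on B̄A. -/

import Mathlib

open scoped TensorProduct

noncomputable section

/-- The sign `(-1)^n` as an integer, for `n : ℤ`. -/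
def pm (n : ℤ) : ℤ := (((-1 : ℤˣ) ^ n : ℤˣ) : ℤ)

/-- The total desuspended degree `Σᵢ (nᵢ - 1)` of a list of (cohomological) degrees;
this is the degree of the bar word `[a₁|⋯|a_k]` when `aᵢ` has degree `nᵢ`. -/
def bdeg (ds : List ℤ) : ℤ := (ds.map (fun n => n - 1)).sum

/-- An augmented, unital, associative differential graded algebra over a commutative
unital ring `R`, with cohomological grading (the differential has degree `+1`).
The grading is internal (`grading_internal`), multiplication and unit are graded,
the differential satisfies the graded Leibniz rule, and the augmentation is a
map of augmented dg algebras.  The operator `sgn` is the canonical "sign" operator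
multiplying the component of degree `i` by `(-1)^i`; it is uniquely determined by the
grading and is included as data for convenience (Koszul signs). -/
structure DGAlgebra (R : Type) [CommRing R] : Type 1 where
  carrier : Type
  [ring : Ring carrier]
  [alg : Algebra R carrier]
  grading : ℤ → Submodule R carrier
  grading_internal : DirectSum.IsInternal grading
  one_mem : (1 : carrier) ∈ grading 0
  mul_mem : ∀ {i j : ℤ} {a b : carrier},
    a ∈ grading i → b ∈ grading j → (a * b) ∈ grading (i + j)
  d : carrier →ₗ[R] carrier
  d_mem : ∀ {i : ℤ} {a : carrier}, a ∈ grading i → d a ∈ grading (i + 1)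
  d_sq : ∀ a, d (d a) = 0
  leibniz : ∀ {i : ℤ} {a b : carrier}, a ∈ grading i →
    d (a * b) = d a * b + pm i • (a * d b)
  aug : carrier →ₐ[R] R
  aug_d : ∀ a, aug (d a) = 0
  aug_graded : ∀ {i : ℤ} {a : carrier}, a ∈ grading i → i ≠ 0 → aug a = 0
  sgn : carrier →ₗ[R] carrier
  sgn_apply : ∀ {i : ℤ} {a : carrier}, a ∈ grading i → sgn a = pm i • a

attribute [instance] DGAlgebra.ring DGAlgebra.alg

namespace DGAlgebra

variable {R : Type} [CommRing R] (A : DGAlgebra R)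

/-- The unnormalized bar construction `BA = T(s⁻¹A)` of `A`, *as a graded `R`-module*.
At the level of (ungraded) `R`-modules it is the tensor algebra on the underlying
module of `A`; the word `[a₁|⋯|a_k]` is the product `ι a₁ ⋯ ι a_k`.  The
(de)suspension is invisible at the module level; it is accounted for by the degree
conventions (`bdeg`) and the sign operators. -/
abbrev Bar : Type := TensorAlgebra R A.carrier

/-- The bar word `[a₁|⋯|a_k] ∈ BA`. The empty word is the counit element `𝟙`. -/
def word (l : List A.carrier) : A.Bar := (l.map (TensorAlgebra.ι R)).prod

/-- `A.Homog l ds` says that the list `l` consists of homogeneous elements,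
`l i` having degree `ds i`. -/
def Homog (l : List A.carrier) (ds : List ℤ) : Prop :=
  l.length = ds.length ∧ ∀ i : ℕ, l.getD i 0 ∈ A.grading (ds.getD i 0)

/-- The concatenation operator `∇ : BA ⊗ BA → BA`. -/
def concat : A.Bar ⊗[R] A.Bar →ₗ[R] A.Bar := LinearMap.mul' R A.Bar

/-- The augmentation ideal `Ā ⊆ A`. -/
def augIdeal : Submodule R A.carrier := LinearMap.ker A.aug.toLinearMap

/-- The normalized bar construction `B̄A = T(s⁻¹Ā)`. -/
abbrev NBar : Type := TensorAlgebra R A.augIdeal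

/-- words in the normalized bar construction. -/
def nword (l : List A.augIdeal) : A.NBar := (l.map (TensorAlgebra.ι R)).prod

/-- The canonical inclusion `B̄A → BA`. -/
def nincl : A.NBar →ₗ[R] A.Bar :=
  (TensorAlgebra.lift R ((TensorAlgebra.ι R) ∘ₗ A.augIdeal.subtype)).toLinearMap

/-- The (internal, total-degree) grading of the bar construction:
`(BA)_n` is spanned by the homogeneous words of total desuspended degree `n`. -/
def barGrading (n : ℤ) : Submodule R A.Bar :=
  Submodule.span R {x | ∃ l ds, A.Homog l ds ∧ bdeg ds = n ∧ x = A.word l}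

end DGAlgebra

/-- All the canonical structure carried by the bar construction `BA` of an augmented
dg algebra `A`: the deconcatenation coproduct `Δ`, the bar differential `dB`
(tensor-product differential plus the `∂` multiplying adjacent entries through the
desuspended multiplication), the sign operator `sgnB`, the graded twist `tw`, the
canonical twisting cochain `α` (projection to `B₁A = s⁻¹A` followed by `σ`), and the
counit `εB`.  Each operator is uniquely determined by its prescribed values on the
words `[a₁|⋯|a_k]`, which span `BA`. -/
structure BarData {R : Type} [CommRing R] (A : DGAlgebra R) : Type where
  /-- deconcatenation coproduct -/
  Δ : A.Bar →ₗ[R] A.Bar ⊗[R] A.Bar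
  Δ_word : ∀ l : List A.carrier,
    Δ (A.word l) = ∑ i ∈ Finset.range (l.length + 1),
      A.word (l.take i) ⊗ₜ[R] A.word (l.drop i)
  /-- the bar differential -/
  dB : A.Bar →ₗ[R] A.Bar
  dB_word : ∀ (l : List A.carrier) (ds : List ℤ), A.Homog l ds →
    dB (A.word l) =
      - (∑ i ∈ Finset.range l.length,
          pm (bdeg (ds.take i)) • A.word (l.set i (A.d (l.getD i 0))))
      + ∑ i ∈ Finset.range (l.length - 1),
          pm (bdeg (ds.take (i + 1))) •
            A.word (l.take i ++ (l.getD i 0 * l.getD (i + 1) 0) :: l.drop (i + 2))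
  /-- the sign operator of `BA` -/
  sgnB : A.Bar →ₗ[R] A.Bar
  sgnB_word : ∀ (l : List A.carrier) (ds : List ℤ), A.Homog l ds →
    sgnB (A.word l) = pm (bdeg ds) • A.word l
  /-- the graded (Koszul) twist `BA ⊗ BA → BA ⊗ BA` -/
  tw : A.Bar ⊗[R] A.Bar →ₗ[R] A.Bar ⊗[R] A.Bar
  tw_word : ∀ (l m : List A.carrier) (ds es : List ℤ), A.Homog l ds → A.Homog m es →
    tw (A.word l ⊗ₜ[R] A.word m) = pm (bdeg ds * bdeg es) • (A.word m ⊗ₜ[R] A.word l)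
  /-- the canonical twisting cochain `α : BA → A` -/
  α : A.Bar →ₗ[R] A.carrier
  α_single : ∀ a : A.carrier, α (A.word [a]) = a
  α_word : ∀ l : List A.carrier, l.length ≠ 1 → α (A.word l) = 0
  /-- the counit of `BA` -/
  εB : A.Bar →ₗ[R] R
  εB_one : εB (1 : A.Bar) = 1
  εB_word : ∀ l : List A.carrier, l ≠ [] → εB (A.word l) = 0

namespace BarData

variable {R : Type} [CommRing R] {A : DGAlgebra R} (BD : BarData A)

/-- `sgnB` raised to the power `n` (only the parity of `n` matters);
used to express Koszul signs `(-1)^{n·|x|}`. -/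
def sgnPow (n : ℤ) : A.Bar →ₗ[R] A.Bar :=
  if n % 2 = 0 then LinearMap.id else BD.sgnB

/-- The differential of `BA ⊗ BA` (with the Koszul sign rule). -/
def dBB : A.Bar ⊗[R] A.Bar →ₗ[R] A.Bar ⊗[R] A.Bar :=
  TensorProduct.map BD.dB LinearMap.id + TensorProduct.map BD.sgnB BD.dB

/-- The middle interchange `1 ⊗ tw ⊗ 1` on `(BA ⊗ BA) ⊗ (BA ⊗ BA)`
(the graded twist of the two middle factors). -/
def midTw : (A.Bar ⊗[R] A.Bar) ⊗[R] (A.Bar ⊗[R] A.Bar) →ₗ[R]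
    (A.Bar ⊗[R] A.Bar) ⊗[R] (A.Bar ⊗[R] A.Bar) :=
  let e₁ := TensorProduct.assoc R A.Bar A.Bar (A.Bar ⊗[R] A.Bar)
  let e₂ := TensorProduct.congr (LinearEquiv.refl R A.Bar)
    (TensorProduct.assoc R A.Bar A.Bar A.Bar).symm
  e₁.symm.toLinearMap ∘ₗ e₂.symm.toLinearMap ∘ₗ
    (TensorProduct.map LinearMap.id (TensorProduct.map BD.tw LinearMap.id)) ∘ₗ
    e₂.toLinearMap ∘ₗ e₁.toLinearMap

/-- The coproduct of `BA ⊗ BA` (with Koszul signs). -/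
def ΔBB : A.Bar ⊗[R] A.Bar →ₗ[R] (A.Bar ⊗[R] A.Bar) ⊗[R] (A.Bar ⊗[R] A.Bar) :=
  BD.midTw ∘ₗ TensorProduct.map BD.Δ BD.Δ

/-- The counit of `BA ⊗ BA`. -/
def εBB : A.Bar ⊗[R] A.Bar →ₗ[R] R :=
  (TensorProduct.lid R R).toLinearMap ∘ₗ TensorProduct.map BD.εB BD.εB

/-- The twisting cochain `β = ε_{BA} ⊗ α : BA ⊗ BA → A`. -/
def β : A.Bar ⊗[R] A.Bar →ₗ[R] A.carrier :=
  (TensorProduct.lid R A.carrier).toLinearMap ∘ₗ TensorProduct.map BD.εB BD.α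

end BarData

/-- `E : BA ⊗ BA → A` is a twisting cochain: it has degree `+1`, satisfies
`E(𝟙,-) = E(-,𝟙) = α` and the twisting cochain equation `d(E) = E ∪ E`,
written as `d∘E + E∘d_{BA⊗BA} = μ_A (E ⊗ E) Δ_{BA⊗BA}` (all Koszul signs being
expressed via the sign operators). -/
structure IsTwistingCochain {R : Type} [CommRing R] {A : DGAlgebra R} (BD : BarData A)
    (E : A.Bar ⊗[R] A.Bar →ₗ[R] A.carrier) : Prop where
  degree : ∀ (l m : List A.carrier) (ds es : List ℤ), A.Homog l ds → A.Homog m es →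
    E (A.word l ⊗ₜ[R] A.word m) ∈ A.grading (bdeg ds + bdeg es + 1)
  unit_left : ∀ b : A.Bar, E ((1 : A.Bar) ⊗ₜ[R] b) = BD.α b
  unit_right : ∀ a : A.Bar, E (a ⊗ₜ[R] (1 : A.Bar)) = BD.α a
  twist : A.d ∘ₗ E + E ∘ₗ BD.dBB =
    LinearMap.mul' R A.carrier ∘ₗ
      TensorProduct.map (E ∘ₗ TensorProduct.map BD.sgnB BD.sgnB) E ∘ₗ BD.ΔBB

/-- A twisting cochain is *normalized* if `E([1],𝟙) = E(𝟙,[1]) = 1`, if `E(a,b) = 0`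
whenever the total bar length is `> 1` and some entry equals `1 ∈ A`, and if
`E(a,b)` lies in the augmentation ideal whenever the total bar length is `> 1`. -/
structure IsNormalized {R : Type} [CommRing R] {A : DGAlgebra R}
    (E : A.Bar ⊗[R] A.Bar →ₗ[R] A.carrier) : Prop where
  one_right : E (A.word [(1 : A.carrier)] ⊗ₜ[R] (1 : A.Bar)) = 1
  one_left : E ((1 : A.Bar) ⊗ₜ[R] A.word [(1 : A.carrier)]) = 1
  vanish : ∀ l m : List A.carrier, 1 < l.length + m.length →
    ((1 : A.carrier) ∈ l ∨ (1 : A.carrier) ∈ m) → E (A.word l ⊗ₜ[R] A.word m) = 0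
  aug_ideal : ∀ l m : List A.carrier, 1 < l.length + m.length →
    A.aug (E (A.word l ⊗ₜ[R] A.word m)) = 0

/-- A twisting cochain has *level 3* if `E(a,b) = 0` whenever `a` has bar length `> 1`. -/
def IsLevel3 {R : Type} [CommRing R] {A : DGAlgebra R}
    (E : A.Bar ⊗[R] A.Bar →ₗ[R] A.carrier) : Prop :=
  ∀ (l m : List A.carrier), 1 < l.length → E (A.word l ⊗ₜ[R] A.word m) = 0

/-- A multiplication on the unnormalized bar construction `BA`: a morphism of
dg coalgebras `BA ⊗ BA → BA` of degree `0` having the counit element `𝟙` as a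
two-sided unit (associativity is *not* required). -/
structure BarMult {R : Type} [CommRing R] {A : DGAlgebra R} (BD : BarData A) : Type where
  f : A.Bar ⊗[R] A.Bar →ₗ[R] A.Bar
  one_mul : ∀ b : A.Bar, f ((1 : A.Bar) ⊗ₜ[R] b) = b
  mul_one : ∀ a : A.Bar, f (a ⊗ₜ[R] (1 : A.Bar)) = a
  graded : ∀ (l m : List A.carrier) (ds es : List ℤ), A.Homog l ds → A.Homog m es →
    f (A.word l ⊗ₜ[R] A.word m) ∈ A.barGrading (bdeg ds + bdeg es)
  chain : BD.dB ∘ₗ f = f ∘ₗ BD.dBB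
  counit : BD.εB ∘ₗ f = BD.εBB
  coalg : BD.Δ ∘ₗ f = TensorProduct.map f f ∘ₗ BD.ΔBB


namespace DGAlgebra

variable {R : Type} [CommRing R] (A : DGAlgebra R)

/-- The differential of `A` restricted to the augmentation ideal. -/
def kD : A.augIdeal →ₗ[R] A.augIdeal :=
  A.d.restrict (p := A.augIdeal) (q := A.augIdeal) (fun x _ => by
    simp only [augIdeal, LinearMap.mem_ker, AlgHom.toLinearMap_apply]
    exact A.aug_d x)

/-- The product of two elements of the augmentation ideal. -/
def kMul (x y : A.augIdeal) : A.augIdeal :=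
  ⟨(x : A.carrier) * (y : A.carrier), by
    have hx : A.aug (x : A.carrier) = 0 := by
      have := x.2; simp only [augIdeal, LinearMap.mem_ker, AlgHom.toLinearMap_apply] at this; exact this
    simp only [augIdeal, LinearMap.mem_ker, AlgHom.toLinearMap_apply, map_mul, hx, zero_mul]⟩

/-- Homogeneity for lists of elements of the augmentation ideal. -/
def HomogN (l : List A.augIdeal) (ds : List ℤ) : Prop :=
  l.length = ds.length ∧ ∀ i : ℕ, ((l.getD i 0 : A.augIdeal) : A.carrier) ∈ A.grading (ds.getD i 0)

/-- The internal grading of the normalized bar construction. -/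
def nbarGrading (n : ℤ) : Submodule R A.NBar :=
  Submodule.span R {x | ∃ l ds, A.HomogN l ds ∧ bdeg ds = n ∧ x = A.nword l}

end DGAlgebra

/-- The canonical structure of the *normalized* bar construction `B̄A = T(s⁻¹Ā)`:
deconcatenation coproduct, bar differential, sign operator, graded twist, canonical
twisting cochain (with values in the augmentation ideal) and counit, each determined by
its values on words. -/
structure NBarData {R : Type} [CommRing R] (A : DGAlgebra R) : Type where
  Δn : A.NBar →ₗ[R] A.NBar ⊗[R] A.NBar
  Δn_word : ∀ l : List A.augIdeal,
    Δn (A.nword l) = ∑ i ∈ Finset.range (l.length + 1),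
      A.nword (l.take i) ⊗ₜ[R] A.nword (l.drop i)
  dn : A.NBar →ₗ[R] A.NBar
  dn_word : ∀ (l : List A.augIdeal) (ds : List ℤ), A.HomogN l ds →
    dn (A.nword l) =
      - (∑ i ∈ Finset.range l.length,
          pm (bdeg (ds.take i)) • A.nword (l.set i (A.kD (l.getD i 0))))
      + ∑ i ∈ Finset.range (l.length - 1),
          pm (bdeg (ds.take (i + 1))) •
            A.nword (l.take i ++ A.kMul (l.getD i 0) (l.getD (i + 1) 0) :: l.drop (i + 2))
  sgnN : A.NBar →ₗ[R] A.NBar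
  sgnN_word : ∀ (l : List A.augIdeal) (ds : List ℤ), A.HomogN l ds →
    sgnN (A.nword l) = pm (bdeg ds) • A.nword l
  twN : A.NBar ⊗[R] A.NBar →ₗ[R] A.NBar ⊗[R] A.NBar
  twN_word : ∀ (l m : List A.augIdeal) (ds es : List ℤ), A.HomogN l ds → A.HomogN m es →
    twN (A.nword l ⊗ₜ[R] A.nword m) = pm (bdeg ds * bdeg es) • (A.nword m ⊗ₜ[R] A.nword l)
  αn : A.NBar →ₗ[R] A.augIdeal
  αn_single : ∀ a : A.augIdeal, αn (A.nword [a]) = a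
  αn_word : ∀ l : List A.augIdeal, l.length ≠ 1 → αn (A.nword l) = 0
  εn : A.NBar →ₗ[R] R
  εn_one : εn (1 : A.NBar) = 1
  εn_word : ∀ l : List A.augIdeal, l ≠ [] → εn (A.nword l) = 0

namespace NBarData

variable {R : Type} [CommRing R] {A : DGAlgebra R} (ND : NBarData A)

/-- differential of `B̄A ⊗ B̄A`. -/
def dnBB : A.NBar ⊗[R] A.NBar →ₗ[R] A.NBar ⊗[R] A.NBar :=
  TensorProduct.map ND.dn LinearMap.id + TensorProduct.map ND.sgnN ND.dn

/-- middle interchange `1 ⊗ tw ⊗ 1` for the normalized bar construction. -/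
def midTwN : (A.NBar ⊗[R] A.NBar) ⊗[R] (A.NBar ⊗[R] A.NBar) →ₗ[R]
    (A.NBar ⊗[R] A.NBar) ⊗[R] (A.NBar ⊗[R] A.NBar) :=
  let e₁ := TensorProduct.assoc R A.NBar A.NBar (A.NBar ⊗[R] A.NBar)
  let e₂ := TensorProduct.congr (LinearEquiv.refl R A.NBar)
    (TensorProduct.assoc R A.NBar A.NBar A.NBar).symm
  e₁.symm.toLinearMap ∘ₗ e₂.symm.toLinearMap ∘ₗ
    (TensorProduct.map LinearMap.id (TensorProduct.map ND.twN LinearMap.id)) ∘ₗ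
    e₂.toLinearMap ∘ₗ e₁.toLinearMap

/-- coproduct of `B̄A ⊗ B̄A`. -/
def ΔnBB : A.NBar ⊗[R] A.NBar →ₗ[R] (A.NBar ⊗[R] A.NBar) ⊗[R] (A.NBar ⊗[R] A.NBar) :=
  ND.midTwN ∘ₗ TensorProduct.map ND.Δn ND.Δn

/-- counit of `B̄A ⊗ B̄A`. -/
def εnBB : A.NBar ⊗[R] A.NBar →ₗ[R] R :=
  (TensorProduct.lid R R).toLinearMap ∘ₗ TensorProduct.map ND.εn ND.εn

end NBarData

/-- A multiplication on the normalized bar construction `B̄A`: a morphism of dg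
coalgebras `B̄A ⊗ B̄A → B̄A` of degree `0` with the counit element `𝟙` as two-sided
unit (associativity not required). -/
structure NBarMult {R : Type} [CommRing R] {A : DGAlgebra R} (ND : NBarData A) : Type where
  f : A.NBar ⊗[R] A.NBar →ₗ[R] A.NBar
  one_mul : ∀ b : A.NBar, f ((1 : A.NBar) ⊗ₜ[R] b) = b
  mul_one : ∀ a : A.NBar, f (a ⊗ₜ[R] (1 : A.NBar)) = a
  graded : ∀ (l m : List A.augIdeal) (ds es : List ℤ), A.HomogN l ds → A.HomogN m es →
    f (A.nword l ⊗ₜ[R] A.nword m) ∈ A.nbarGrading (bdeg ds + bdeg es)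
  chain : ND.dn ∘ₗ f = f ∘ₗ ND.dnBB
  counit : ND.εn ∘ₗ f = ND.εnBB
  coalg : ND.Δn ∘ₗ f = TensorProduct.map f f ∘ₗ ND.ΔnBB

/-! ## Helper material -/

namespace NBH

theorem pm_zero : pm 0 = 1 := by simp [pm]
theorem pm_add (a b : ℤ) : pm (a + b) = pm a * pm b := by simp [pm, zpow_add]
theorem pm_neg_one : pm (-1) = -1 := by simp [pm]
theorem pm_one : pm 1 = -1 := by simp [pm]
theorem pm_sq (a : ℤ) : pm a * pm a = 1 := by
  unfold pm; rw [← Units.val_mul, Int.units_mul_self]; rfl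
theorem pm_sub_one (a : ℤ) : pm (a - 1) = - pm a := by
  rw [sub_eq_add_neg, pm_add, pm_neg_one]; ring

/-- Sum over all ways to split a list in two. -/
def ss {X M : Type} [AddCommMonoid M] : List X → (List X → List X → M) → M
  | [], F => F [] []
  | a :: l, F => F [] (a :: l) + ss l (fun x y => F (a :: x) y)

section
variable {X M N : Type} [AddCommMonoid M] [AddCommMonoid N]

@[simp] theorem ss_nil (F : List X → List X → M) : ss [] F = F [] [] := rfl
theorem ss_cons (a : X) (l : List X) (F : List X → List X → M) :
    ss (a :: l) F = F [] (a :: l) + ss l (fun x y => F (a :: x) y) := rfl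

theorem ss_congr (l : List X) : ∀ {F G : List X → List X → M},
    (∀ x y, x ++ y = l → F x y = G x y) → ss l F = ss l G := by
  induction l with
  | nil => intro F G h; exact h _ _ rfl
  | cons a l ih =>
    intro F G h
    rw [ss_cons, ss_cons, h [] (a :: l) rfl, ih]
    intro x y hxy; exact h _ _ (by simp [hxy])

theorem ss_add (l : List X) : ∀ (F G : List X → List X → M),
    ss l (fun x y => F x y + G x y) = ss l F + ss l G := by
  induction l with
  | nil => intro F G; rfl
  | cons a l ih => intro F G; simp only [ss_cons, ih]; abel

theorem ss_zero (l : List X) : ss l (fun _ _ => (0 : M)) = 0 := by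
  induction l with
  | nil => rfl
  | cons a l ih => simp [ss_cons, ih]

theorem map_ss {Φ : Type} [FunLike Φ M N] [AddMonoidHomClass Φ M N] (φ : Φ) (l : List X) :
    ∀ (F : List X → List X → M), φ (ss l F) = ss l (fun x y => φ (F x y)) := by
  induction l with
  | nil => intro F; rfl
  | cons a l ih => intro F; simp only [ss_cons, map_add, ih]

theorem ss_comm {Y : Type} (l : List X) (m : List Y) :
    ∀ (F : List X → List X → List Y → List Y → M),
    ss l (fun x y => ss m (fun z w => F x y z w)) =
      ss m (fun z w => ss l (fun x y => F x y z w)) := by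
  induction l with
  | nil => intro F; rfl
  | cons a l ih => intro F; simp only [ss_cons, ih, ss_add]

theorem ss_coassoc (l : List X) : ∀ (G : List X → List X → List X → M),
    ss l (fun p r => ss p (fun x y => G x y r)) =
      ss l (fun x q => ss q (fun y r => G x y r)) := by
  induction l with
  | nil => intro F; rfl
  | cons a l ih => intro F; simp only [ss_cons, ss_nil, ss_add, ih]; abel

theorem ss_map {Y : Type} (φ : X → Y) (l : List X) : ∀ (F : List Y → List Y → M),
    ss (l.map φ) F = ss l (fun x y => F (x.map φ) (y.map φ)) := by
  induction l with
  | nil => intro F; rfl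
  | cons a l ih => intro F; simp only [List.map_cons, ss_cons, ih, List.map_nil]

theorem ss_left (l : List X) (F : List X → List X → M) (h : ∀ a x y, F (a :: x) y = 0) :
    ss l F = F [] l := by
  cases l with
  | nil => rfl
  | cons a l => simp [ss_cons, h, ss_zero]

theorem ss_right (l : List X) : ∀ (F : List X → List X → M) (_ : ∀ x b y, F x (b :: y) = 0),
    ss l F = F l [] := by
  induction l with
  | nil => intro F _; rfl
  | cons a l ih => intro F h; rw [ss_cons, h, zero_add, ih _ (fun x b y => h _ _ _)]

theorem ss_range (l : List X) : ∀ (F : List X → List X → M),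
    ∑ i ∈ Finset.range (l.length + 1), F (l.take i) (l.drop i) = ss l F := by
  induction l with
  | nil => intro F; simp
  | cons a l ih =>
    intro F
    rw [List.length_cons, Finset.sum_range_succ', ss_cons, ← ih]
    simp [add_comm]
end

theorem smul_ss {X M K : Type} [AddCommGroup M] [Monoid K] [DistribMulAction K M]
    (k : K) (l : List X) (F : List X → List X → M) :
    k • ss l F = ss l (fun x y => k • F x y) :=
  map_ss (DistribSMul.toAddMonoidHom M k) l F

section
variable {R V : Type} [CommRing R] [AddCommGroup V] [Module R V] (gr : ℤ → Submodule R V)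

/-- homogeneous letters -/
abbrev Lt : Type := Σ n : ℤ, gr n

variable {gr}

def val (x : Lt gr) : V := (x.2 : V)
def ldeg (l : List (Lt gr)) : ℤ := bdeg (l.map Sigma.fst)

@[simp] theorem ldeg_nil : ldeg ([] : List (Lt gr)) = 0 := by simp [ldeg, bdeg]
theorem ldeg_cons (a : Lt gr) (l : List (Lt gr)) : ldeg (a :: l) = (a.1 - 1) + ldeg l := by
  simp [ldeg, bdeg]
theorem ldeg_append (l m : List (Lt gr)) : ldeg (l ++ m) = ldeg l + ldeg m := by
  simp [ldeg, bdeg]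

def W (l : List (Lt gr)) : TensorAlgebra R V := ((l.map val).map (TensorAlgebra.ι R)).prod

@[simp] theorem W_nil : W ([] : List (Lt gr)) = 1 := rfl
theorem W_cons (a : Lt gr) (l : List (Lt gr)) :
    W (a :: l) = TensorAlgebra.ι R (val a) * W l := by simp [W]
theorem W_append (l m : List (Lt gr)) : W (l ++ m) = W l * W m := by simp [W]

variable (gr) in
/-- pairs of words -/
abbrev PW : Type := List (Lt gr) × List (Lt gr)

open scoped TensorProduct
def W2 (p : PW gr) : TensorAlgebra R V ⊗[R] TensorAlgebra R V := W p.1 ⊗ₜ[R] W p.2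
def pdeg (p : PW gr) : ℤ := ldeg p.1 + ldeg p.2
def plen (p : PW gr) : ℕ := p.1.length + p.2.length

def S {M : Type} [AddCommGroup M] (p : PW gr) (F : PW gr → PW gr → M) : M :=
  ss p.1 fun l₁ l₂ => ss p.2 fun m₁ m₂ => pm (ldeg l₂ * ldeg m₁) • F (l₁, m₁) (l₂, m₂)

variable {M N : Type} [AddCommGroup M] [AddCommGroup N]

theorem S_congr' (p : PW gr) {F G : PW gr → PW gr → M}
    (h : ∀ a b, a.1 ++ b.1 = p.1 → a.2 ++ b.2 = p.2 → F a b = G a b) : S p F = S p G := by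
  refine ss_congr _ fun l₁ l₂ hl => ss_congr _ fun m₁ m₂ hm => ?_
  rw [h _ _ hl hm]

theorem S_congr (p : PW gr) {F G : PW gr → PW gr → M}
    (h : ∀ a b, F a b = G a b) : S p F = S p G := S_congr' p fun a b _ _ => h a b

theorem S_add (p : PW gr) (F G : PW gr → PW gr → M) :
    S p (fun a b => F a b + G a b) = S p F + S p G := by
  simp only [S, smul_add, ss_add]

theorem map_S {Φ : Type} [FunLike Φ M N] [AddMonoidHomClass Φ M N] (φ : Φ) (p : PW gr)
    (F : PW gr → PW gr → M) : φ (S p F) = S p (fun a b => φ (F a b)) := by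
  simp only [S, map_ss, map_zsmul]

theorem S_neg (p : PW gr) (F : PW gr → PW gr → M) :
    S p (fun a b => - F a b) = - S p F := (map_S (-(AddMonoidHom.id M)) p F).symm

theorem S_sub (p : PW gr) (F G : PW gr → PW gr → M) :
    S p (fun a b => F a b - G a b) = S p F - S p G := by
  simp only [sub_eq_add_neg, S_add, S_neg]

theorem S_smul (k : ℤ) (p : PW gr) (F : PW gr → PW gr → M) :
    k • S p F = S p (fun a b => k • F a b) :=
  map_S (DistribSMul.toAddMonoidHom M k) p F

theorem S_zero (p : PW gr) : S p (fun _ _ => (0 : M)) = 0 := by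
  simp [S, ss_zero]

theorem S_coassoc (p : PW gr) (G : PW gr → PW gr → PW gr → M) :
    S p (fun q r => S q (fun a b => G a b r)) = S p (fun a q => S q (fun b r => G a b r)) := by
  obtain ⟨l, m⟩ := p
  have h1 : S (l, m) (fun q r => S q (fun a b => G a b r)) =
      ss l fun q l₃ => ss q fun l₁ l₂ => ss m fun n m₃ => ss n fun m₁ m₂ =>
        pm (ldeg l₃ * ldeg m₁ + ldeg l₃ * ldeg m₂ + ldeg l₂ * ldeg m₁) •
          G (l₁, m₁) (l₂, m₂) (l₃, m₃) := by
    refine ss_congr _ fun q l₃ _ => ?_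
    rw [ss_comm]
    refine ss_congr _ fun n m₃ _ => ?_
    simp only [S, smul_ss]
    refine ss_congr _ fun l₁ l₂ _ => ss_congr _ fun m₁ m₂ hm => ?_
    rw [← hm, ldeg_append, smul_smul, ← pm_add, mul_add]
  have h2 : S (l, m) (fun a q => S q (fun b r => G a b r)) =
      ss l fun l₁ q => ss q fun l₂ l₃ => ss m fun m₁ n => ss n fun m₂ m₃ =>
        pm (ldeg l₃ * ldeg m₁ + ldeg l₃ * ldeg m₂ + ldeg l₂ * ldeg m₁) •
          G (l₁, m₁) (l₂, m₂) (l₃, m₃) := by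
    refine ss_congr _ fun l₁ q _ => ?_
    rw [ss_comm]
    refine ss_congr _ fun m₁ n _ => ?_
    simp only [S, smul_ss]
    refine ss_congr _ fun l₂ l₃ hl => ss_congr _ fun m₂ m₃ hm => ?_
    rw [← hl, ldeg_append, smul_smul, ← pm_add, add_mul]
    congr 2; ring
  rw [h1, h2, ss_coassoc]
  refine ss_congr _ fun _ _ _ => ss_congr _ fun _ _ _ => ?_
  rw [ss_coassoc]

/-- terms with first factor empty drop out -/
theorem S_left (p : PW gr) (F : PW gr → PW gr → M)
    (h : ∀ a b, a ≠ ([], []) → F a b = 0) : S p F = F ([], []) p := by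
  unfold S
  rw [ss_left]
  · rw [ss_left]
    · simp [pm_zero]
    · intro a x y; rw [h _ _ (by simp), smul_zero]
  · intro a x y
    rw [← ss_zero (M := M) p.2]
    refine ss_congr _ fun _ _ _ => ?_
    rw [h _ _ (by simp), smul_zero]

theorem S_right (p : PW gr) (F : PW gr → PW gr → M)
    (h : ∀ a b, b ≠ ([], []) → F a b = 0) : S p F = F p ([], []) := by
  unfold S
  rw [ss_right]
  · rw [ss_right]
    · simp [pm_zero]
    · intro a x y; rw [h _ _ (by simp), smul_zero]
  · intro a x y
    rw [← ss_zero (M := M) p.2]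
    refine ss_congr _ fun _ _ _ => ?_
    rw [h _ _ (by simp), smul_zero]

/-- congruence for recursion: the empty first factor contributes nothing. -/
theorem S_rec (p : PW gr) {F G : PW gr → PW gr → M}
    (h0 : ∀ b, F ([], []) b = G ([], []) b)
    (h : ∀ a b, plen b < plen p → pdeg a + pdeg b = pdeg p → F a b = G a b) :
    S p F = S p G := by
  refine S_congr' p fun a b h1 h2 => ?_
  by_cases ha : a = ([], [])
  · subst ha; exact h0 b
  · apply h
    · obtain ⟨a1, a2⟩ := a
      unfold plen
      rw [← h1, ← h2, List.length_append, List.length_append]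
      have : 0 < a1.length ∨ 0 < a2.length := by
        by_contra hc
        push Not at hc
        apply ha
        simp only [nonpos_iff_eq_zero, List.length_eq_zero_iff] at hc
        rw [hc.1, hc.2]
      simp only; omega
    · unfold pdeg; rw [← h1, ← h2, ldeg_append, ldeg_append]; ring

theorem W2_nil : W2 (([], []) : PW gr) = (1 : TensorAlgebra R V) ⊗ₜ[R] 1 := rfl

/-- spanning -/
theorem span_W (hs : iSup gr = ⊤) :
    Submodule.span R (Set.range (W (gr := gr))) = ⊤ := by
  rw [eq_top_iff]
  rintro x -
  induction x using TensorAlgebra.induction with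
  | algebraMap r =>
    rw [Algebra.algebraMap_eq_smul_one]
    exact Submodule.smul_mem _ _ (Submodule.subset_span ⟨[], rfl⟩)
  | ι v =>
    have hv : v ∈ iSup gr := hs ▸ Submodule.mem_top
    induction hv using Submodule.iSup_induction' with
    | mem n v hv => exact Submodule.subset_span ⟨[⟨n, v, hv⟩], by simp [W, val]⟩
    | zero => simp
    | add x y _ _ hx hy => rw [map_add]; exact Submodule.add_mem _ hx hy
  | mul a b ha hb =>
    have := Submodule.mul_mem_mul ha hb
    rw [Submodule.span_mul_span] at this
    refine Submodule.span_mono ?_ this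
    rintro _ ⟨_, ⟨l, rfl⟩, _, ⟨m, rfl⟩, rfl⟩
    exact ⟨l ++ m, W_append _ _⟩
  | add a b ha hb => exact Submodule.add_mem _ ha hb

theorem ext_W (hs : iSup gr = ⊤) {Q : Type} [AddCommMonoid Q] [Module R Q]
    {f g : TensorAlgebra R V →ₗ[R] Q} (h : ∀ l : List (Lt gr), f (W l) = g (W l)) : f = g :=
  LinearMap.ext_on_range (span_W hs) h

theorem ext_W2 (hs : iSup gr = ⊤) {Q : Type} [AddCommMonoid Q] [Module R Q]
    {f g : TensorAlgebra R V ⊗[R] TensorAlgebra R V →ₗ[R] Q}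
    (h : ∀ p : PW gr, f (W2 p) = g (W2 p)) : f = g := by
  apply TensorProduct.ext
  apply ext_W hs; intro l
  apply ext_W hs; intro m
  exact h (l, m)

theorem span_W2 (hs : iSup gr = ⊤) :
    Submodule.span R (Set.range (W2 (gr := gr))) = ⊤ := by
  have := TensorProduct.span_tmul_eq_top R (TensorAlgebra R V) (TensorAlgebra R V)
  have h : ∀ f g : (TensorAlgebra R V ⊗[R] TensorAlgebra R V) →ₗ[R] 
      ((TensorAlgebra R V ⊗[R] TensorAlgebra R V) ⧸ 
        Submodule.span R (Set.range (W2 (gr := gr)))), 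
      (∀ p : PW gr, f (W2 p) = g (W2 p)) → f = g := fun f g => ext_W2 hs
  have h2 := h (Submodule.mkQ _) 0 (fun p => by
    simp only [Submodule.mkQ_apply, LinearMap.zero_apply, Submodule.Quotient.mk_eq_zero]
    exact Submodule.subset_span ⟨p, rfl⟩)
  rw [← Submodule.ker_mkQ (Submodule.span R (Set.range (W2 (gr := gr)))), h2, LinearMap.ker_zero]

/-- grading on the tensor algebra -/
def Tgr (gr : ℤ → Submodule R V) (n : ℤ) : Submodule R (TensorAlgebra R V) :=
  Submodule.span R {x | ∃ l : List (Lt gr), ldeg l = n ∧ x = W l}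

theorem W_mem (l : List (Lt gr)) : W l ∈ Tgr gr (ldeg l) := Submodule.subset_span ⟨l, rfl, rfl⟩

theorem ι_mul_mem {n k : ℤ} {v : V} (hv : v ∈ gr n) {x : TensorAlgebra R V}
    (hx : x ∈ Tgr gr k) : TensorAlgebra.ι R v * x ∈ Tgr gr (n - 1 + k) := by
  have : Tgr gr k ≤ (Tgr gr (n - 1 + k)).comap (LinearMap.mulLeft R (TensorAlgebra.ι R v)) := by
    refine Submodule.span_le.2 ?_
    rintro _ ⟨l, hl, rfl⟩
    exact Submodule.subset_span ⟨⟨n, v, hv⟩ :: l, by rw [ldeg_cons, hl], by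
      rw [W_cons]; rfl⟩
  exact this hx

theorem exists_limit {C T : Type} [AddCommGroup C] [Module R C] [AddCommGroup T] [Module R T]
    (fn : ℕ → C →ₗ[R] T) {s : Set C} (hs : Submodule.span R s = ⊤)
    (h : ∀ x ∈ s, ∃ N, ∀ n ≥ N, fn n x = fn N x) :
    ∃ f : C →ₗ[R] T, ∀ x, ∃ N, ∀ n ≥ N, fn n x = f x := by
  have key : ∀ x, ∃ y N, ∀ n ≥ N, fn n x = y := by
    intro x
    have hx : x ∈ Submodule.span R s := hs ▸ Submodule.mem_top
    induction hx using Submodule.span_induction with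
    | mem x hx => obtain ⟨N, hN⟩ := h x hx; exact ⟨_, N, hN⟩
    | zero => exact ⟨0, 0, fun n _ => map_zero _⟩
    | add a b _ _ ha hb =>
      obtain ⟨y, N, hN⟩ := ha
      obtain ⟨z, K, hK⟩ := hb
      exact ⟨y + z, max N K, fun n hn => by
        rw [map_add, hN n (le_trans (le_max_left _ _) hn), hK n (le_trans (le_max_right _ _) hn)]⟩
    | smul r a _ ha =>
      obtain ⟨y, N, hN⟩ := ha
      exact ⟨r • y, N, fun n hn => by rw [map_smul, hN n hn]⟩
  choose y N hN using key
  refine ⟨{ toFun := y, map_add' := ?_, map_smul' := ?_ }, fun x => ⟨N x, hN x⟩⟩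
  · intro a b
    rw [← hN (a + b) (max (N (a + b)) (max (N a) (N b))) (le_max_left _ _), map_add,
      hN a _ (le_trans (le_max_left _ _) (le_max_right _ _)),
      hN b _ (le_trans (le_max_right _ _) (le_max_right _ _))]
  · intro r a
    rw [← hN (r • a) (max (N (r • a)) (N a)) (le_max_left _ _), map_smul,
      hN a _ (le_max_right _ _)]; rfl
end
section
open scoped TensorProduct
variable {R V : Type} [CommRing R] [AddCommGroup V] [Module R V]

theorem val_mem {gr : ℤ → Submodule R V} (a : Lt gr) : val a ∈ gr a.1 := a.2.2

def wd (l : List V) : TensorAlgebra R V := (l.map (TensorAlgebra.ι R)).prod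

def Hom (gr : ℤ → Submodule R V) (l : List V) (ds : List ℤ) : Prop :=
  l.length = ds.length ∧ ∀ i : ℕ, l.getD i 0 ∈ gr (ds.getD i 0)

theorem hom_map {gr : ℤ → Submodule R V} (L : List (Lt gr)) :
    Hom gr (L.map val) (L.map Sigma.fst) := by
  refine ⟨by simp, ?_⟩
  induction L with
  | nil => intro i; simp
  | cons a L ih =>
    intro i
    cases i with
    | zero => simpa using val_mem a
    | succ i => simpa using ih i

theorem exists_lift {gr : ℤ → Submodule R V} : ∀ (l : List V) (ds : List ℤ), Hom gr l ds →
    ∃ L : List (Lt gr), L.map val = l ∧ L.map Sigma.fst = ds := by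
  intro l
  induction l with
  | nil =>
    intro ds h
    have : ds = [] := List.length_eq_zero_iff.1 h.1.symm
    exact ⟨[], rfl, this.symm⟩
  | cons a l ih =>
    intro ds h
    cases ds with
    | nil => exact absurd h.1 (by simp)
    | cons n ds =>
      obtain ⟨L, h1, h2⟩ := ih ds ⟨by simpa using h.1, fun i => by simpa using h.2 (i + 1)⟩
      exact ⟨⟨n, a, by simpa using h.2 0⟩ :: L, by simp [h1, val], by simp [h2]⟩

/-- The bar construction data on a tensor algebra, uniformly for `A` and `Ā`. -/
structure Core (gr : ℤ → Submodule R V) : Type where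
  span : iSup gr = ⊤
  d : V →ₗ[R] V
  d_mem : ∀ {n : ℤ} {v : V}, v ∈ gr n → d v ∈ gr (n + 1)
  μ : V →ₗ[R] V →ₗ[R] V
  mul_mem : ∀ {n k : ℤ} {v w : V}, v ∈ gr n → w ∈ gr k → μ v w ∈ gr (n + k)
  Δ : TensorAlgebra R V →ₗ[R] TensorAlgebra R V ⊗[R] TensorAlgebra R V
  Δ_word : ∀ l : List V,
    Δ (wd l) = ∑ i ∈ Finset.range (l.length + 1), wd (l.take i) ⊗ₜ[R] wd (l.drop i)
  dB : TensorAlgebra R V →ₗ[R] TensorAlgebra R V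
  dB_word : ∀ (l : List V) (ds : List ℤ), Hom gr l ds →
    dB (wd l) =
      - (∑ i ∈ Finset.range l.length,
          pm (bdeg (ds.take i)) • wd (l.set i (d (l.getD i 0))))
      + ∑ i ∈ Finset.range (l.length - 1),
          pm (bdeg (ds.take (i + 1))) •
            wd (l.take i ++ (μ (l.getD i 0) (l.getD (i + 1) 0)) :: l.drop (i + 2))
  sgn : TensorAlgebra R V →ₗ[R] TensorAlgebra R V
  sgn_word : ∀ (l : List V) (ds : List ℤ), Hom gr l ds →
    sgn (wd l) = pm (bdeg ds) • wd l
  tw : TensorAlgebra R V ⊗[R] TensorAlgebra R V →ₗ[R] TensorAlgebra R V ⊗[R] TensorAlgebra R V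
  tw_word : ∀ (l m : List V) (ds es : List ℤ), Hom gr l ds → Hom gr m es →
    tw (wd l ⊗ₜ[R] wd m) = pm (bdeg ds * bdeg es) • (wd m ⊗ₜ[R] wd l)
  α : TensorAlgebra R V →ₗ[R] V
  α_single : ∀ a : V, α (wd [a]) = a
  α_word : ∀ l : List V, l.length ≠ 1 → α (wd l) = 0
  ε : TensorAlgebra R V →ₗ[R] R
  ε_one : ε 1 = 1
  ε_word : ∀ l : List V, l ≠ [] → ε (wd l) = 0

namespace Core
variable {gr : ℤ → Submodule R V} (K : Core gr)

local notation "𝕋" => TensorAlgebra R V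
local notation "j" => TensorAlgebra.ι R

theorem Δ_W (l : List (Lt gr)) : K.Δ (W l) = ss l (fun x y => W x ⊗ₜ[R] W y) := by
  have := K.Δ_word (l.map val)
  rw [ss_range (l.map val) (fun x y => wd x ⊗ₜ[R] wd y), ss_map] at this
  exact this

theorem sgn_W (l : List (Lt gr)) : K.sgn (W l) = pm (ldeg l) • W l :=
  K.sgn_word _ _ (hom_map l)

theorem tw_W (l m : List (Lt gr)) :
    K.tw (W l ⊗ₜ[R] W m) = pm (ldeg l * ldeg m) • (W m ⊗ₜ[R] W l) :=
  K.tw_word _ _ _ _ (hom_map l) (hom_map m)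

theorem ε_W_cons (a : Lt gr) (l : List (Lt gr)) : K.ε (W (a :: l)) = 0 :=
  K.ε_word _ (by simp)

theorem α_one : K.α 1 = 0 := K.α_word [] (by simp)

theorem ε_ι (v : V) (x : 𝕋) : K.ε (j v * x) = 0 := by
  have : K.ε ∘ₗ LinearMap.mulLeft R (j v) = 0 := by
    apply ext_W K.span
    intro l
    have := K.ε_word (v :: l.map val) (by simp)
    simpa [wd, W] using this
  exact LinearMap.congr_fun this x

theorem α_ι (v : V) (x : 𝕋) : K.α (j v * x) = K.ε x • v := by
  have : K.α ∘ₗ LinearMap.mulLeft R (j v) = K.ε.smulRight v := by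
    apply ext_W K.span
    intro l
    cases l with
    | nil => simpa [wd, W, K.ε_one] using K.α_single v
    | cons a l =>
      have := K.α_word (v :: (a :: l).map val) (by simp)
      simpa [wd, W, K.ε_ι] using this
  exact LinearMap.congr_fun this x

theorem Δ_one : K.Δ 1 = 1 ⊗ₜ[R] 1 := K.Δ_W []

theorem Δ_ι (v : V) (x : 𝕋) : K.Δ (j v * x) = 1 ⊗ₜ[R] (j v * x) +
    TensorProduct.map (LinearMap.mulLeft R (j v)) LinearMap.id (K.Δ x) := by
  have : K.Δ ∘ₗ LinearMap.mulLeft R (j v) =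
      TensorProduct.mk R 𝕋 𝕋 1 ∘ₗ LinearMap.mulLeft R (j v) +
      TensorProduct.map (LinearMap.mulLeft R (j v)) LinearMap.id ∘ₗ K.Δ := by
    apply ext_W K.span
    intro l
    have h := K.Δ_word (v :: l.map val)
    rw [ss_range (v :: l.map val) (fun x y => wd x ⊗ₜ[R] wd y), ss_cons, ss_map] at h
    have h1 : wd (v :: l.map val) = j v * W l := by simp [wd, W]
    rw [h1] at h
    simp only [LinearMap.comp_apply, LinearMap.mulLeft_apply, h, LinearMap.add_apply,
      TensorProduct.mk_apply, Δ_W, map_ss, TensorProduct.map_tmul, LinearMap.id_apply]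
    congr 1
  exact LinearMap.congr_fun this x

/-- multiplication into the first letter -/
def h (v : V) : 𝕋 →ₗ[R] 𝕋 :=
  LinearMap.mul' R 𝕋 ∘ₗ TensorProduct.map (TensorAlgebra.ι R ∘ₗ K.μ v ∘ₗ K.α) LinearMap.id ∘ₗ K.Δ

theorem h_one (v : V) : K.h v 1 = 0 := by
  simp [h, Δ_one, α_one]

theorem counit_l (x : 𝕋) : LinearMap.mul' R 𝕋 (TensorProduct.map
    (Algebra.linearMap R 𝕋 ∘ₗ K.ε) LinearMap.id (K.Δ x)) = x := by
  have : LinearMap.mul' R 𝕋 ∘ₗ TensorProduct.map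
    (Algebra.linearMap R 𝕋 ∘ₗ K.ε) LinearMap.id ∘ₗ K.Δ = LinearMap.id := by
    apply ext_W K.span
    intro l
    simp only [LinearMap.comp_apply, Δ_W, map_ss]
    rw [ss_left]
    · simp [K.ε_one]
    · intro a x y; simp [K.ε_W_cons]
  exact LinearMap.congr_fun this x

theorem h_ι (v w : V) (x : 𝕋) : K.h v (j w * x) = j (K.μ v w) * x := by
  simp only [h, LinearMap.comp_apply, Δ_ι, map_add]
  have h1 : (LinearMap.mul' R 𝕋) (TensorProduct.map (TensorAlgebra.ι R ∘ₗ K.μ v ∘ₗ K.α)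
      LinearMap.id ((1 : 𝕋) ⊗ₜ[R] (j w * x))) = 0 := by simp [α_one]
  rw [h1, zero_add]
  conv_rhs => rw [← K.counit_l x]
  generalize K.Δ x = t
  induction t using TensorProduct.induction_on with
  | zero => simp
  | add a b ha hb => simp only [map_add, ha, hb, mul_add]
  | tmul a b =>
    simp [α_ι, ← Algebra.smul_def]

/-- reconstruct an element from first letter and rest -/
theorem recon (x : 𝕋) : x = algebraMap R 𝕋 (K.ε x) + LinearMap.mul' R 𝕋 (TensorProduct.map
    (TensorAlgebra.ι R ∘ₗ K.α) LinearMap.id (K.Δ x)) := by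
  have : (LinearMap.id : 𝕋 →ₗ[R] 𝕋) = Algebra.linearMap R 𝕋 ∘ₗ K.ε + LinearMap.mul' R 𝕋 ∘ₗ
      TensorProduct.map (TensorAlgebra.ι R ∘ₗ K.α) LinearMap.id ∘ₗ K.Δ := by
    apply ext_W K.span
    intro l
    cases l with
    | nil => simp [K.ε_one, Δ_one, α_one]
    | cons a l =>
      simp only [LinearMap.add_apply, LinearMap.comp_apply, ε_W_cons, map_zero, zero_add,
        LinearMap.id_apply]
      rw [W_cons, Δ_ι, map_add, map_add]
      have h1 : (LinearMap.mul' R 𝕋) (TensorProduct.map (TensorAlgebra.ι R ∘ₗ K.α)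
        LinearMap.id ((1 : 𝕋) ⊗ₜ[R] (j (val a) * W l))) = 0 := by simp [α_one]
      rw [h1, zero_add]
      conv_lhs => rw [← K.counit_l (W l)]
      generalize K.Δ (W l) = t
      induction t using TensorProduct.induction_on with
      | zero => simp
      | add a b ha hb => simp only [map_add, ← ha, ← hb, mul_add]
      | tmul a b =>
        simp [α_ι, ← Algebra.smul_def]
  exact LinearMap.congr_fun this x

theorem wd_cons (v : V) (l : List V) : wd (R := R) (v :: l) = j v * wd l := by simp [wd]

theorem dB_wd_cons (v : V) (l : List V) (n : ℤ) (ds : List ℤ) (hl : Hom gr l ds)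
    (hv : v ∈ gr n) : K.dB (wd (v :: l)) = - (j (K.d v) * wd l)
      + pm (n - 1) • (j v * K.dB (wd l) + K.h v (wd l)) := by
  have hb : ∀ (m : ℤ) (es : List ℤ), bdeg (m :: es) = (m - 1) + bdeg es := by
    intro m es; simp [bdeg]
  have hh : Hom gr (v :: l) (n :: ds) := by
    refine ⟨by simp [hl.1], fun i => ?_⟩
    cases i with
    | zero => simpa using hv
    | succ i => simpa using hl.2 i
  rw [K.dB_word _ _ hh, K.dB_word _ _ hl]
  rw [List.length_cons, Finset.sum_range_succ']
  have e1 : ∀ i, pm (bdeg (List.take (i + 1) (n :: ds))) •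
      wd (R := R) ((v :: l).set (i + 1) (K.d ((v :: l).getD (i + 1) 0))) =
      pm (n - 1) • (j v * pm (bdeg (ds.take i)) • wd (l.set i (K.d (l.getD i 0)))) := by
    intro i
    simp only [List.take_succ_cons, hb, pm_add, List.set_cons_succ, List.getD_cons_succ, wd_cons,
      mul_smul, mul_smul_comm]
  rw [Finset.sum_congr rfl (fun i _ => e1 i), ← Finset.smul_sum, ← Finset.mul_sum]
  have e0 : pm (bdeg (List.take 0 (n :: ds))) •
      wd (R := R) ((v :: l).set 0 (K.d ((v :: l).getD 0 0))) = j (K.d v) * wd l := by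
    simp [bdeg, pm_zero, wd_cons]
  rw [e0]
  have e2 : ∑ i ∈ Finset.range (l.length + 1 - 1), pm (bdeg (List.take (i + 1) (n :: ds))) •
      wd (R := R) (List.take i (v :: l) ++ K.μ ((v :: l).getD i 0) ((v :: l).getD (i + 1) 0) ::
        List.drop (i + 2) (v :: l)) = pm (n - 1) • (j v * (∑ i ∈ Finset.range (l.length - 1),
          pm (bdeg (ds.take (i + 1))) •
            wd (l.take i ++ (K.μ (l.getD i 0) (l.getD (i + 1) 0)) :: l.drop (i + 2)))
              + K.h v (wd l)) := by
    cases l with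
    | nil =>
      have : K.h v (wd []) = 0 := K.h_one v
      simp [this]
    | cons w l =>
      rw [List.length_cons, Nat.add_sub_cancel, Nat.add_sub_cancel, Finset.sum_range_succ',
        wd_cons w l, h_ι, smul_add, Finset.mul_sum, Finset.smul_sum]
      congr 1
      · refine Finset.sum_congr rfl fun i _ => ?_
        simp only [List.take_succ_cons, hb, pm_add, List.getD_cons_succ, wd_cons,
          mul_smul, mul_smul_comm, List.cons_append, List.drop_succ_cons]
      · simp [wd_cons, bdeg]
  rw [e2]
  simp only [mul_add, smul_add, mul_neg, smul_neg]
  abel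

theorem dB_one : K.dB 1 = 0 := by
  have := K.dB_word [] [] ⟨rfl, fun i => by simp⟩
  simpa [wd] using this

theorem dB_ι {n : ℤ} {v : V} (hv : v ∈ gr n) (x : 𝕋) :
    K.dB (j v * x) = - (j (K.d v) * x) + pm (n - 1) • (j v * K.dB x + K.h v x) := by
  have : K.dB ∘ₗ LinearMap.mulLeft R (j v) = - LinearMap.mulLeft R (j (K.d v)) +
      pm (n - 1) • (LinearMap.mulLeft R (j v) ∘ₗ K.dB + K.h v) := by
    apply ext_W K.span
    intro l
    have := K.dB_wd_cons v (l.map val) n _ (hom_map l) hv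
    rw [wd_cons] at this
    exact this
  exact LinearMap.congr_fun this x

theorem ε_dB (x : 𝕋) : K.ε (K.dB x) = 0 := by
  have : K.ε ∘ₗ K.dB = 0 := by
    apply ext_W K.span
    intro l
    induction l with
    | nil => simp [dB_one]
    | cons a l ih =>
      have : ∀ x, K.ε (K.h (val a) x) = 0 := by
        intro x
        have : K.ε ∘ₗ K.h (val a) = 0 := by
          apply ext_W K.span
          intro m
          cases m with
          | nil => simp [h_one]
          | cons b m => simp [W_cons, h_ι, ε_ι]
        exact LinearMap.congr_fun this x
      rw [LinearMap.comp_apply, W_cons, K.dB_ι (val_mem a)]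
      simp only [map_add, map_neg, map_zsmul, ε_ι, this, neg_zero, add_zero, smul_zero,
        LinearMap.zero_apply]
  exact LinearMap.congr_fun this x

theorem h_mem {n k : ℤ} {v : V} (hv : v ∈ gr n) {x : 𝕋} (hx : x ∈ Tgr gr k) :
    K.h v x ∈ Tgr gr (n + k) := by
  have : Tgr gr k ≤ (Tgr gr (n + k)).comap (K.h v) := by
    refine Submodule.span_le.2 ?_
    rintro _ ⟨l, hl, rfl⟩
    show K.h v (W l) ∈ Tgr gr (n + k)
    cases l with
    | nil => rw [W_nil, h_one]; exact Submodule.zero_mem _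
    | cons a l =>
      rw [W_cons, h_ι]
      have := ι_mul_mem (K.mul_mem hv (val_mem a)) (W_mem l)
      rw [ldeg_cons] at hl
      convert this using 2
      rw [← hl]; ring
  exact this hx

theorem dB_W_mem (l : List (Lt gr)) : K.dB (W l) ∈ Tgr gr (ldeg l + 1) := by
  induction l with
  | nil => rw [W_nil, dB_one]; exact Submodule.zero_mem _
  | cons a l ih =>
    rw [W_cons, K.dB_ι (val_mem a), ldeg_cons]
    refine Submodule.add_mem _ (Submodule.neg_mem _ ?_) (zsmul_mem (Submodule.add_mem _ ?_ ?_) _)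
    · convert ι_mul_mem (K.d_mem (val_mem a)) (W_mem l) using 2; ring
    · convert ι_mul_mem (val_mem a) ih using 2; ring
    · convert K.h_mem (val_mem a) (W_mem l) using 2; ring

theorem Δ_dB (x : 𝕋) : K.Δ (K.dB x) = TensorProduct.map K.dB LinearMap.id (K.Δ x) +
    TensorProduct.map K.sgn K.dB (K.Δ x) := by
  have : K.Δ ∘ₗ K.dB = TensorProduct.map K.dB LinearMap.id ∘ₗ K.Δ +
      TensorProduct.map K.sgn K.dB ∘ₗ K.Δ := by
    apply ext_W K.span
    intro l
    induction l with
    | nil => 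
      simp [Δ_one, dB_one]
    | cons a l ih =>
      simp only [LinearMap.comp_apply, LinearMap.add_apply] at ih ⊢
      have hsg : ∀ x, K.sgn (j (val a) * x) = pm (a.1 - 1) • (j (val a) * K.sgn x) := by
        intro x
        have : K.sgn ∘ₗ LinearMap.mulLeft R (j (val a)) =
            pm (a.1 - 1) • (LinearMap.mulLeft R (j (val a)) ∘ₗ K.sgn) := by
          apply ext_W K.span
          intro m
          have := K.sgn_W (a :: m)
          rw [ldeg_cons, pm_add, mul_smul, W_cons] at this
          simp only [LinearMap.comp_apply, LinearMap.mulLeft_apply, LinearMap.smul_apply, this,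
            sgn_W, mul_smul_comm]
        exact LinearMap.congr_fun this x
      have e1 : ∀ t : 𝕋 ⊗[R] 𝕋, TensorProduct.map K.dB LinearMap.id (TensorProduct.map
          (LinearMap.mulLeft R (j (val a))) LinearMap.id t) =
          - TensorProduct.map (LinearMap.mulLeft R (j (K.d (val a)))) LinearMap.id t
          + pm (a.1 - 1) • (TensorProduct.map (LinearMap.mulLeft R (j (val a))) LinearMap.id
            (TensorProduct.map K.dB LinearMap.id t) +
            TensorProduct.map (K.h (val a)) LinearMap.id t) := by
        intro t
        induction t using TensorProduct.induction_on with
        | zero => simp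
        | add a b ha hb => simp only [map_add, ha, hb, smul_add]; abel
        | tmul x y =>
          simp only [TensorProduct.map_tmul, LinearMap.mulLeft_apply, LinearMap.id_apply,
            K.dB_ι (val_mem a), TensorProduct.add_tmul, TensorProduct.neg_tmul,
            TensorProduct.smul_tmul', smul_add]
      have e2 : ∀ t : 𝕋 ⊗[R] 𝕋, TensorProduct.map K.sgn K.dB (TensorProduct.map
          (LinearMap.mulLeft R (j (val a))) LinearMap.id t) =
          pm (a.1 - 1) • (TensorProduct.map (LinearMap.mulLeft R (j (val a))) LinearMap.id
            (TensorProduct.map K.sgn K.dB t)) := by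
        intro t
        induction t using TensorProduct.induction_on with
        | zero => simp
        | add a b ha hb => simp only [map_add, ha, hb, smul_add]
        | tmul x y =>
          simp only [TensorProduct.map_tmul, LinearMap.mulLeft_apply, LinearMap.id_apply,
            hsg, TensorProduct.smul_tmul']
      have e3 : K.Δ (K.h (val a) (W l)) = 1 ⊗ₜ[R] K.h (val a) (W l) +
          TensorProduct.map (K.h (val a)) LinearMap.id (K.Δ (W l)) := by
        cases l with
        | nil => simp [h_one, Δ_one]
        | cons b l =>
          have : (K.h (val a)) ∘ₗ (LinearMap.mulLeft R (j (val b))) =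
              LinearMap.mulLeft R (j (K.μ (val a) (val b))) := by
            ext x; simp [h_ι]
          rw [W_cons, h_ι, Δ_ι, Δ_ι, map_add, TensorProduct.map_tmul, h_one,
            TensorProduct.zero_tmul, zero_add, ← this]
          generalize K.Δ (W l) = t
          congr 1
          exact (LinearMap.congr_fun (TensorProduct.map_comp (K.h (val a)) LinearMap.id
            (LinearMap.mulLeft R (j (val b))) LinearMap.id) t)
      have hs1 : K.sgn 1 = 1 := by simpa [pm_zero] using K.sgn_W []
      rw [W_cons, K.Δ_ι, map_add, map_add, e1, e2, TensorProduct.map_tmul, TensorProduct.map_tmul,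
        dB_one, hs1, K.dB_ι (val_mem a)]
      rw [map_add, map_neg, map_zsmul, map_add, Δ_ι, Δ_ι, e3, ih]
      simp only [map_add, TensorProduct.tmul_add, TensorProduct.tmul_neg, TensorProduct.zero_tmul,
        TensorProduct.tmul_smul, smul_add, LinearMap.id_apply]
      abel
  exact LinearMap.congr_fun this x

end Core
end
section
open scoped TensorProduct
variable {R V : Type} [CommRing R] [AddCommGroup V] [Module R V]
namespace Core
variable {gr : ℤ → Submodule R V} (K : Core gr)

local notation "𝕋" => TensorAlgebra R V
local notation "j" => TensorAlgebra.ι R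

def dC : 𝕋 ⊗[R] 𝕋 →ₗ[R] 𝕋 ⊗[R] 𝕋 :=
  TensorProduct.map K.dB LinearMap.id + TensorProduct.map K.sgn K.dB

def midTw : (𝕋 ⊗[R] 𝕋) ⊗[R] (𝕋 ⊗[R] 𝕋) →ₗ[R] (𝕋 ⊗[R] 𝕋) ⊗[R] (𝕋 ⊗[R] 𝕋) :=
  let e₁ := TensorProduct.assoc R 𝕋 𝕋 (𝕋 ⊗[R] 𝕋)
  let e₂ := TensorProduct.congr (LinearEquiv.refl R 𝕋)
    (TensorProduct.assoc R 𝕋 𝕋 𝕋).symm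
  e₁.symm.toLinearMap ∘ₗ e₂.symm.toLinearMap ∘ₗ
    (TensorProduct.map LinearMap.id (TensorProduct.map K.tw LinearMap.id)) ∘ₗ
    e₂.toLinearMap ∘ₗ e₁.toLinearMap

def ΔC : 𝕋 ⊗[R] 𝕋 →ₗ[R] (𝕋 ⊗[R] 𝕋) ⊗[R] (𝕋 ⊗[R] 𝕋) :=
  K.midTw ∘ₗ TensorProduct.map K.Δ K.Δ

def εC : 𝕋 ⊗[R] 𝕋 →ₗ[R] R :=
  (TensorProduct.lid R R).toLinearMap ∘ₗ TensorProduct.map K.ε K.ε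

theorem tw_hom {n k : ℤ} {x y : 𝕋} (hx : x ∈ Tgr gr n) (hy : y ∈ Tgr gr k) :
    K.tw (x ⊗ₜ[R] y) = pm (n * k) • (y ⊗ₜ[R] x) := by
  induction hx using Submodule.span_induction with
  | zero => simp
  | add a b _ _ ha hb => simp only [TensorProduct.add_tmul, TensorProduct.tmul_add, map_add, ha, hb, smul_add]
  | smul r a _ ha =>
    rw [← TensorProduct.smul_tmul', map_smul, ha, TensorProduct.tmul_smul, smul_comm]
  | mem x hx =>
    obtain ⟨l, rfl, rfl⟩ := hx
    induction hy using Submodule.span_induction with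
    | zero => simp
    | add a b _ _ ha hb => simp only [TensorProduct.add_tmul, TensorProduct.tmul_add, map_add, ha, hb, smul_add]
    | smul r a _ ha =>
      rw [← TensorProduct.smul_tmul', TensorProduct.tmul_smul, map_smul, ha, smul_comm]
    | mem x hx =>
      obtain ⟨m, rfl, rfl⟩ := hx
      exact K.tw_W l m

theorem midTw_hom {n k : ℤ} (x w : 𝕋) {y z : 𝕋} (hy : y ∈ Tgr gr n) (hz : z ∈ Tgr gr k) :
    K.midTw ((x ⊗ₜ[R] y) ⊗ₜ[R] (z ⊗ₜ[R] w)) =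
      pm (n * k) • ((x ⊗ₜ[R] z) ⊗ₜ[R] (y ⊗ₜ[R] w)) := by
  simp only [midTw, LinearMap.comp_apply, LinearEquiv.coe_coe, TensorProduct.assoc_tmul,
    TensorProduct.congr_tmul, LinearEquiv.refl_apply, TensorProduct.assoc_symm_tmul,
    TensorProduct.map_tmul, K.tw_hom hy hz, LinearMap.id_apply]
  rw [← TensorProduct.smul_tmul', TensorProduct.tmul_smul, map_zsmul, map_zsmul]
  congr 1

theorem zsmul_ss {X M : Type} [AddCommGroup M]
    (k : ℤ) (l : List X) (F : List X → List X → M) :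
    k • ss l F = ss l (fun x y => k • F x y) :=
  map_ss (DistribSMul.toAddMonoidHom M k) l F

theorem ss_add_smul {X M : Type} [AddCommGroup M]
    (k : ℤ) (l : List X) (F G : List X → List X → M) :
    ss l F + k • ss l G = ss l (fun x y => F x y + k • G x y) := by
  rw [zsmul_ss, ← ss_add]

theorem tmul_zs_left {P Q P' Q' : Type} [AddCommGroup P] [Module R P] [AddCommGroup Q] [Module R Q]
    [AddCommGroup P'] [Module R P'] [AddCommGroup Q'] [Module R Q']
    (n : ℤ) (a b : P ⊗[R] Q) (c : P' ⊗[R] Q') :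
    (a + n • b) ⊗ₜ[R] c = a ⊗ₜ[R] c + n • (b ⊗ₜ[R] c) := by
  rw [TensorProduct.add_tmul]
  congr 1

theorem tmul_zs_right {P Q P' Q' : Type} [AddCommGroup P] [Module R P] [AddCommGroup Q] [Module R Q]
    [AddCommGroup P'] [Module R P'] [AddCommGroup Q'] [Module R Q']
    (n : ℤ) (a b : P ⊗[R] Q) (c : P' ⊗[R] Q') :
    c ⊗ₜ[R] (a + n • b) = c ⊗ₜ[R] a + n • (c ⊗ₜ[R] b) := by
  rw [TensorProduct.tmul_add]
  congr 1
  exact map_zsmul (TensorProduct.mk R (P' ⊗[R] Q') (P ⊗[R] Q) c) n b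

theorem midTw_zs (n : ℤ) (b : (𝕋 ⊗[R] 𝕋) ⊗[R] (𝕋 ⊗[R] 𝕋)) :
    K.midTw (n • b) = n • K.midTw b := map_zsmul K.midTw n b

theorem ss_tmul {P Q : Type} [AddCommGroup P] [Module R P] [AddCommGroup Q] [Module R Q]
    {X Y : Type} (l : List X) (m : List Y) (F : List X → List X → P) (G : List Y → List Y → Q) :
    ss l F ⊗ₜ[R] ss m G = ss l fun x y => ss m fun z w => F x y ⊗ₜ[R] G z w := by
  have h1 : ∀ q : Q, ss l F ⊗ₜ[R] q = ss l fun x y => F x y ⊗ₜ[R] q := fun q =>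
    map_ss ((TensorProduct.mk R P Q).flip q) l F
  rw [h1]
  refine ss_congr _ fun x y _ => ?_
  exact map_ss (TensorProduct.mk R P Q (F x y)) m G

theorem ΔC_W2 (p : PW gr) : K.ΔC (W2 p) = S p (fun a b => W2 a ⊗ₜ[R] W2 b) := by
  obtain ⟨l, m⟩ := p
  simp only [ΔC, W2, LinearMap.comp_apply, TensorProduct.map_tmul, Δ_W, ss_tmul, map_ss, S]
  refine ss_congr _ fun x y _ => ss_congr _ fun z w _ => ?_
  exact K.midTw_hom _ _ (W_mem _) (W_mem _)

theorem dC_W2 (p : PW gr) : K.dC (W2 p) = K.dB (W p.1) ⊗ₜ[R] W p.2 +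
    pm (ldeg p.1) • (W p.1 ⊗ₜ[R] K.dB (W p.2)) := by
  simp only [dC, W2, LinearMap.add_apply, TensorProduct.map_tmul, sgn_W, LinearMap.id_apply,
    TensorProduct.smul_tmul']

theorem Δ_dB_W (l : List (Lt gr)) : K.Δ (K.dB (W l)) = ss l fun x y =>
    K.dB (W x) ⊗ₜ[R] W y + pm (ldeg x) • (W x ⊗ₜ[R] K.dB (W y)) := by
  rw [Δ_dB, Δ_W, map_ss, map_ss, ← ss_add]
  refine ss_congr _ fun x y _ => ?_
  simp only [TensorProduct.map_tmul, sgn_W, LinearMap.id_apply, TensorProduct.smul_tmul']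

theorem sign_aux {M : Type} [AddCommGroup M] (s x y z : ℤ) (hy : y * y = 1) (X Y Z U : M) :
    s • X + x • (s * z) • Y + (x * y) • ((s * y) • Z + z • s • U) =
      s • (X + x • Z + (x * z) • (Y + y • U)) := by
  have e1 : x * y * (s * y) = s * x := by linear_combination (x * s) * hy
  have e2 : x * (s * z) = s * (x * z) := by ring
  have e3 : x * y * (z * s) = s * (x * z * y) := by ring
  simp only [smul_add, smul_smul, e1, e2, e3]
  abel

theorem ΔC_dC (p : PW gr) : K.ΔC (K.dC (W2 p)) = S p (fun a b =>
    K.dC (W2 a) ⊗ₜ[R] W2 b + pm (pdeg a) • (W2 a ⊗ₜ[R] K.dC (W2 b))) := by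
  obtain ⟨l, m⟩ := p
  rw [dC_W2, map_add, map_zsmul]
  simp only [ΔC, LinearMap.comp_apply, TensorProduct.map_tmul, Δ_W, Δ_dB_W, ss_tmul, map_ss, S]
  refine (ss_add_smul (M := (𝕋 ⊗[R] 𝕋) ⊗[R] (𝕋 ⊗[R] 𝕋)) _ _ _ _).trans ?_
  refine ss_congr _ fun x y hl => ?_
  refine (ss_add_smul (M := (𝕋 ⊗[R] 𝕋) ⊗[R] (𝕋 ⊗[R] 𝕋)) _ _ _ _).trans ?_
  refine ss_congr _ fun z w hm => ?_
  subst hl; subst hm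
  rw [tmul_zs_left, tmul_zs_right, map_add, map_add, midTw_zs, midTw_zs]
  rw [K.midTw_hom _ _ (W_mem y) (W_mem z), K.midTw_hom _ _ (K.dB_W_mem y) (W_mem z),
    K.midTw_hom _ _ (W_mem y) (K.dB_W_mem z), K.midTw_hom _ _ (W_mem y) (W_mem z)]
  rw [dC_W2, dC_W2, tmul_zs_left, tmul_zs_right]
  simp only [W2, pdeg]
  simp only [ldeg_append, pm_add, add_mul, mul_add, mul_one, one_mul]
  exact sign_aux (M := (𝕋 ⊗[R] 𝕋) ⊗[R] (𝕋 ⊗[R] 𝕋)) _ _ _ _ (pm_sq _) _ _ _ _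

theorem εC_nil : K.εC (W2 (([], []) : PW gr)) = 1 := by simp [εC, W2, K.ε_one]
theorem εC_ne (p : PW gr) (hp : p ≠ ([], [])) : K.εC (W2 p) = 0 := by
  obtain ⟨l, m⟩ := p
  cases l with
  | cons a l => simp [εC, W2, ε_W_cons]
  | nil =>
    cases m with
    | nil => exact absurd rfl hp
    | cons a l => simp [εC, W2, ε_W_cons]

theorem εC_dC (x : 𝕋 ⊗[R] 𝕋) : K.εC (K.dC x) = 0 := by
  induction x using TensorProduct.induction_on with
  | zero => simp
  | add a b ha hb => simp [ha, hb]
  | tmul a b => simp [εC, dC, ε_dB]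

/-- convolution -/
def conv (φ : 𝕋 ⊗[R] 𝕋 →ₗ[R] V) (ψ : 𝕋 ⊗[R] 𝕋 →ₗ[R] 𝕋) : 𝕋 ⊗[R] 𝕋 →ₗ[R] 𝕋 :=
  LinearMap.mul' R 𝕋 ∘ₗ TensorProduct.map (TensorAlgebra.ι R ∘ₗ φ) ψ ∘ₗ K.ΔC

theorem conv_W2 (φ : 𝕋 ⊗[R] 𝕋 →ₗ[R] V) (ψ : 𝕋 ⊗[R] 𝕋 →ₗ[R] 𝕋) (p : PW gr) :
    K.conv φ ψ (W2 p) = S p (fun a b => j (φ (W2 a)) * ψ (W2 b)) := by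
  simp [conv, ΔC_W2, map_S]

theorem conv_dC (φ : 𝕋 ⊗[R] 𝕋 →ₗ[R] V) (ψ : 𝕋 ⊗[R] 𝕋 →ₗ[R] 𝕋) (p : PW gr) :
    K.conv φ ψ (K.dC (W2 p)) = S p (fun a b => j (φ (K.dC (W2 a))) * ψ (W2 b) +
      pm (pdeg a) • (j (φ (W2 a)) * ψ (K.dC (W2 b)))) := by
  simp only [conv, LinearMap.comp_apply, ΔC_dC, map_S, map_add, map_zsmul, TensorProduct.map_tmul,
    LinearMap.mul'_apply]

/-- the recursion characterising the coalgebra map generated by `E` -/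
def Rec (E : 𝕋 ⊗[R] 𝕋 →ₗ[R] V) (f : 𝕋 ⊗[R] 𝕋 →ₗ[R] 𝕋) : Prop :=
  f = Algebra.linearMap R 𝕋 ∘ₗ K.εC + K.conv E f

variable {K}
variable {E : TensorAlgebra R V ⊗[R] TensorAlgebra R V →ₗ[R] V}
variable {f : TensorAlgebra R V ⊗[R] TensorAlgebra R V →ₗ[R] TensorAlgebra R V}

theorem Rec.apply (hf : K.Rec E f) (p : PW gr) : f (W2 p) = algebraMap R 𝕋 (K.εC (W2 p)) +
    S p (fun a b => j (E (W2 a)) * f (W2 b)) := by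
  have := LinearMap.congr_fun hf (W2 p)
  rw [LinearMap.add_apply, conv_W2] at this
  exact this

theorem plen_induction {C : PW gr → Prop} (H : ∀ p, (∀ q, plen q < plen p → C q) → C p) (p : PW gr) :
    C p := by
  induction hn : plen p using Nat.strong_induction_on generalizing p with
  | _ n ih => exact H p fun q hq => ih _ (hn ▸ hq) q rfl

theorem Rec.unique {f' : 𝕋 ⊗[R] 𝕋 →ₗ[R] 𝕋} (h0 : E (W2 (([], []) : PW gr)) = 0)
    (hf : K.Rec E f) (hf' : K.Rec E f') : f = f' := by
  apply ext_W2 K.span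
  intro p
  induction p using plen_induction with
  | H p ih =>
    rw [hf.apply, hf'.apply]
    congr 1
    apply S_rec
    · intro b; rw [h0]; simp
    · intro a b hb _; rw [ih b hb]

variable (K) in
theorem exists_Rec (h0 : E (W2 (([], []) : PW gr)) = 0) : ∃ f, K.Rec E f := by
  obtain ⟨fn, hfn⟩ : ∃ fn : ℕ → 𝕋 ⊗[R] 𝕋 →ₗ[R] 𝕋,
      ∀ n, fn (n + 1) = Algebra.linearMap R 𝕋 ∘ₗ K.εC + K.conv E (fn n) :=
    ⟨fun n => Nat.rec 0 (fun _ g => Algebra.linearMap R 𝕋 ∘ₗ K.εC + K.conv E g) n, fun n => rfl⟩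
  have hfa : ∀ n (p : PW gr), fn (n + 1) (W2 p) = algebraMap R 𝕋 (K.εC (W2 p)) +
      S p (fun a b => j (E (W2 a)) * fn n (W2 b)) := by
    intro n p; rw [hfn, LinearMap.add_apply, conv_W2]; rfl
  have hst : ∀ n (p : PW gr), plen p < n → fn (n + 1) (W2 p) = fn n (W2 p) := by
    intro n
    induction n with
    | zero => intro p hp; omega
    | succ n ih =>
      intro p hp
      rw [hfa (n + 1) p, hfa n p]
      congr 1
      apply S_rec
      · intro b; rw [h0]; simp
      · intro a b hb _; rw [ih b (by omega)]
  have hst2 : ∀ (p : PW gr) n, n ≥ plen p + 1 → fn n (W2 p) = fn (plen p + 1) (W2 p) := by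
    intro p n hn
    induction n, hn using Nat.le_induction with
    | base => rfl
    | succ n hn ih => rw [hst n p (by omega), ih]
  obtain ⟨f, hf⟩ := exists_limit fn (span_W2 K.span) (by
    rintro _ ⟨p, rfl⟩; exact ⟨_, hst2 p⟩)
  have hf2 : ∀ (p : PW gr) n, n ≥ plen p + 1 → fn n (W2 p) = f (W2 p) := by
    intro p n hn
    obtain ⟨N, hN⟩ := hf (W2 p)
    rw [hst2 p n hn, ← hst2 p (max N (plen p + 1)) (le_max_right _ _), hN _ (le_max_left _ _)]
  refine ⟨f, ext_W2 K.span fun p => ?_⟩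
  rw [LinearMap.add_apply, conv_W2, ← hf2 p (plen p + 1 + 1) (by omega), hfa (plen p + 1) p]
  congr 1
  apply S_rec
  · intro b; rw [h0]; simp
  · intro a b hb _; rw [hf2 b _ (by omega)]

theorem Rec.counit (hf : K.Rec E f) : K.ε ∘ₗ f = K.εC := by
  apply ext_W2 K.span; intro p
  rw [LinearMap.comp_apply, hf.apply, map_add, map_S, Algebra.algebraMap_eq_smul_one, map_smul,
    K.ε_one]
  simp [ε_ι, S_zero]

theorem Rec.alpha (hf : K.Rec E f) : K.α ∘ₗ f = E := by
  apply ext_W2 K.span; intro p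
  rw [LinearMap.comp_apply, hf.apply, map_add, map_S, Algebra.algebraMap_eq_smul_one, map_smul,
    α_one, smul_zero, zero_add]
  have : ∀ b : PW gr, K.ε (f (W2 b)) = K.εC (W2 b) := fun b => LinearMap.congr_fun hf.counit _
  simp only [α_ι, this]
  rw [S_right, εC_nil, one_smul]
  intro a b hb; rw [εC_ne _ _ hb, zero_smul]

theorem Rec.coalg (h0 : E (W2 (([], []) : PW gr)) = 0) (hf : K.Rec E f) :
    K.Δ ∘ₗ f = TensorProduct.map f f ∘ₗ K.ΔC := by
  have e1 : ∀ p : PW gr, K.Δ (f (W2 p)) = 1 ⊗ₜ[R] f (W2 p) + S p (fun a b =>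
      TensorProduct.map (LinearMap.mulLeft R (j (E (W2 a)))) LinearMap.id (K.Δ (f (W2 b)))) := by
    intro p
    have h1 : (1 : 𝕋) ⊗ₜ[R] f (W2 p) = K.Δ (algebraMap R 𝕋 (K.εC (W2 p))) +
        S p (fun a b => (1 : 𝕋) ⊗ₜ[R] (j (E (W2 a)) * f (W2 b))) := by
      rw [hf.apply, TensorProduct.tmul_add, Algebra.algebraMap_eq_smul_one, map_smul, Δ_one,
        TensorProduct.tmul_smul]
      congr 1
      exact map_S (TensorProduct.mk R 𝕋 𝕋 1) p _
    rw [h1, add_assoc, ← S_add, hf.apply, map_add, map_S]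
    simp only [Δ_ι]
  have e2 : ∀ p : PW gr, TensorProduct.map f f (K.ΔC (W2 p)) = 1 ⊗ₜ[R] f (W2 p) + S p (fun a b =>
      TensorProduct.map (LinearMap.mulLeft R (j (E (W2 a)))) LinearMap.id
        (TensorProduct.map f f (K.ΔC (W2 b)))) := by
    intro p
    have h1 : ∀ a b : PW gr, f (W2 a) ⊗ₜ[R] f (W2 b) =
        algebraMap R 𝕋 (K.εC (W2 a)) ⊗ₜ[R] f (W2 b) +
        S a (fun a b' => (j (E (W2 a)) * f (W2 b')) ⊗ₜ[R] f (W2 b)) := by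
      intro a b
      rw [hf.apply a, TensorProduct.add_tmul]
      congr 1
      exact map_S ((TensorProduct.mk R 𝕋 𝕋).flip (f (W2 b))) a _
    simp only [ΔC_W2, map_S, TensorProduct.map_tmul]
    simp only [LinearMap.mulLeft_apply, LinearMap.id_apply]
    rw [← S_coassoc p (fun a b c => (j (E (W2 a)) * f (W2 b)) ⊗ₜ[R] f (W2 c))]
    rw [S_congr p h1, S_add]
    congr 1
    rw [S_left, εC_nil, map_one]
    intro a b ha; rw [εC_ne _ _ ha, map_zero, TensorProduct.zero_tmul]
  apply ext_W2 K.span; intro p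
  rw [LinearMap.comp_apply, LinearMap.comp_apply]
  induction p using plen_induction with
  | H p ih =>
    rw [e1, e2]
    congr 1
    apply S_rec
    · intro b; rw [h0]; simp
    · intro a b hb _; rw [ih b hb]

theorem Rec.graded (h0 : E (W2 (([], []) : PW gr)) = 0)
    (hdeg : ∀ p : PW gr, E (W2 p) ∈ gr (pdeg p + 1)) (hf : K.Rec E f) (p : PW gr) :
    f (W2 p) ∈ Tgr gr (pdeg p) := by
  induction p using plen_induction with
  | H p ih =>
    rw [hf.apply]
    refine Submodule.add_mem _ ?_ ?_
    · by_cases hp : p = ([], [])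
      · subst hp
        rw [εC_nil, map_one]
        exact W_mem []
      · rw [εC_ne _ _ hp, map_zero]; exact Submodule.zero_mem _
    · rw [← Submodule.Quotient.mk_eq_zero, ← Submodule.mkQ_apply, map_S, ← S_zero p]
      apply S_rec
      · intro b; rw [h0]; simp
      · intro a b hb hab
        rw [Submodule.mkQ_apply, Submodule.Quotient.mk_eq_zero]
        convert ι_mul_mem (hdeg a) (ih b hb) using 2
        rw [← hab]; ring

theorem Rec.one_mul (hl : ∀ b, E (1 ⊗ₜ[R] b) = K.α b) (hf : K.Rec E f) (b : 𝕋) :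
    f (1 ⊗ₜ[R] b) = b := by
  have : f ∘ₗ TensorProduct.mk R 𝕋 𝕋 1 = LinearMap.id := by
    apply ext_W K.span
    intro l
    induction l with
    | nil =>
      have := hf.apply ([], [])
      rw [εC_nil, map_one] at this
      simp only [S, ss_nil, W2, W_nil, hl, α_one, map_zero, zero_mul, smul_zero, add_zero] at this
      exact this
    | cons a l ih =>
      have := hf.apply ([], a :: l)
      rw [εC_ne _ _ (by simp), map_zero, zero_add] at this
      simp only [S, ss_nil, W2, W_nil, hl, ss_cons, α_one, map_zero, zero_mul, smul_zero,
        zero_add, ldeg_nil, pm_zero, one_smul] at this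
      rw [ss_left] at this
      · simp only [LinearMap.comp_apply, TensorProduct.mk_apply] at ih ⊢
        rw [this, ih]
        rw [W_cons, W_cons, α_ι, W_nil, K.ε_one, one_smul]; rfl
      · intro b x y
        rw [W_cons a, α_ι, ε_W_cons, zero_smul]; simp
  exact LinearMap.congr_fun this b

theorem Rec.mul_one (hr : ∀ b, E (b ⊗ₜ[R] 1) = K.α b) (hf : K.Rec E f) (b : 𝕋) :
    f (b ⊗ₜ[R] 1) = b := by
  have : f ∘ₗ (TensorProduct.mk R 𝕋 𝕋).flip 1 = LinearMap.id := by
    apply ext_W K.span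
    intro l
    induction l with
    | nil =>
      have := hf.apply ([], [])
      rw [εC_nil, map_one] at this
      simp only [S, ss_nil, W2, W_nil, hr, α_one, map_zero, zero_mul, smul_zero, add_zero] at this
      exact this
    | cons a l ih =>
      have := hf.apply (a :: l, [])
      rw [εC_ne _ _ (by simp), map_zero, zero_add] at this
      simp only [S, ss_nil, W2, W_nil, hr, ss_cons, α_one, map_zero, zero_mul, smul_zero,
        zero_add, ldeg_nil, pm_zero, one_smul, mul_zero] at this
      rw [ss_left] at this
      · simp only [LinearMap.comp_apply, TensorProduct.mk_apply, LinearMap.flip_apply] at ih ⊢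
        rw [this, ih]
        rw [W_cons, W_cons, α_ι, W_nil, K.ε_one, one_smul]; rfl
      · intro b x y
        rw [W_cons a, α_ι, ε_W_cons, zero_smul]; simp
  exact LinearMap.congr_fun this b

variable (K E) in
/-- the twisting equation on words -/
def Twist : Prop := ∀ p : PW gr, K.d (E (W2 p)) + E (K.dC (W2 p)) =
    S p (fun a b => pm (pdeg a) • K.μ (E (W2 a)) (E (W2 b)))

theorem h_f (hf : K.Rec E f) (v : V) (p : PW gr) :
    K.h v (f (W2 p)) = S p (fun a b => j (K.μ v (E (W2 a))) * f (W2 b)) := by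
  rw [hf.apply, map_add, map_S, Algebra.algebraMap_eq_smul_one, map_smul, h_one, smul_zero,
    zero_add]
  simp only [h_ι]

theorem dB_f (hdeg : ∀ p : PW gr, E (W2 p) ∈ gr (pdeg p + 1)) (hf : K.Rec E f) (p : PW gr) :
    K.dB (f (W2 p)) = S p (fun a b => - (j (K.d (E (W2 a))) * f (W2 b)) +
      pm (pdeg a) • (j (E (W2 a)) * K.dB (f (W2 b)) + K.h (E (W2 a)) (f (W2 b)))) := by
  rw [hf.apply, map_add, map_S, Algebra.algebraMap_eq_smul_one, map_smul, dB_one, smul_zero,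
    zero_add]
  refine S_congr p fun a b => ?_
  rw [K.dB_ι (hdeg a), add_sub_cancel_right]

theorem Rec.chain (h0 : E (W2 (([], []) : PW gr)) = 0)
    (hdeg : ∀ p : PW gr, E (W2 p) ∈ gr (pdeg p + 1)) (ht : K.Twist E) (hf : K.Rec E f) :
    K.dB ∘ₗ f = f ∘ₗ K.dC := by
  have key : ∀ p : PW gr, K.dB (f (W2 p)) - f (K.dC (W2 p)) = S p (fun a b =>
      pm (pdeg a) • (j (E (W2 a)) * (K.dB (f (W2 b)) - f (K.dC (W2 b))))) := by
    intro p
    have e1 := dB_f hdeg hf p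
    have e2 : f (K.dC (W2 p)) = S p (fun a b => j (E (K.dC (W2 a))) * f (W2 b) +
        pm (pdeg a) • (j (E (W2 a)) * f (K.dC (W2 b)))) := by
      rw [← conv_dC]
      have := LinearMap.congr_fun hf (K.dC (W2 p))
      rw [LinearMap.add_apply, LinearMap.comp_apply, εC_dC, map_zero, zero_add] at this
      exact this
    have e3 : S p (fun a b => pm (pdeg a) • K.h (E (W2 a)) (f (W2 b))) =
        S p (fun a b => (j (K.d (E (W2 a))) + j (E (K.dC (W2 a)))) * f (W2 b)) := by
      have : ∀ a b : PW gr, (j (K.d (E (W2 a))) + j (E (K.dC (W2 a)))) * f (W2 b) =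
          S a (fun a b' => pm (pdeg a) • (j (K.μ (E (W2 a)) (E (W2 b'))) * f (W2 b))) := by
        intro a b
        rw [← map_add, ht a, map_S]
        have := map_S (LinearMap.mulRight R (f (W2 b))) a
          (fun a b => j (pm (pdeg a) • (K.μ (E (W2 a))) (E (W2 b))))
        simp only [LinearMap.mulRight_apply] at this
        rw [this]
        refine S_congr a fun a b' => ?_
        rw [map_zsmul, smul_mul_assoc]
      simp only [this, h_f hf, S_smul]
      rw [S_coassoc p (fun a b' b => pm (pdeg a) • (j (K.μ (E (W2 a)) (E (W2 b'))) * f (W2 b)))]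
    rw [e1, e2, ← S_sub]
    have e4 : S p (fun a b => pm (pdeg a) • K.h (E (W2 a)) (f (W2 b)) -
      (j (K.d (E (W2 a))) + j (E (K.dC (W2 a)))) * f (W2 b)) = 0 := by
      rw [S_sub, e3, sub_self]
    rw [← add_zero (S p (fun a b =>
      pm (pdeg a) • (j (E (W2 a)) * (K.dB (f (W2 b)) - f (K.dC (W2 b)))))), ← e4, ← S_add]
    refine S_congr p fun a b => ?_
    simp only [smul_add, mul_sub, smul_sub, add_mul]
    abel
  apply ext_W2 K.span; intro p
  rw [LinearMap.comp_apply, LinearMap.comp_apply, ← sub_eq_zero]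
  induction p using plen_induction with
  | H p ih =>
    rw [key, ← S_zero p]
    apply S_rec
    · intro b; rw [h0]; simp
    · intro a b hb _; rw [ih b hb]; simp

/-- a coalgebra map satisfies the recursion -/
theorem rec_of_coalg (hc : K.ε ∘ₗ f = K.εC) (hΔ : K.Δ ∘ₗ f = TensorProduct.map f f ∘ₗ K.ΔC) :
    K.Rec (K.α ∘ₗ f) f := by
  apply LinearMap.ext
  intro x
  conv_lhs => rw [K.recon (f x)]
  have h1 : K.ε (f x) = K.εC x := LinearMap.congr_fun hc x
  have h2 : K.Δ (f x) = TensorProduct.map f f (K.ΔC x) := LinearMap.congr_fun hΔ x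
  rw [h1, h2]
  simp only [LinearMap.add_apply, conv, LinearMap.comp_apply, Algebra.linearMap_apply]
  congr 1
  generalize K.ΔC x = t
  induction t using TensorProduct.induction_on with
  | zero => simp
  | add a b ha hb => simp only [map_add, ha, hb]
  | tmul a b => simp

theorem α_h (v : V) (x : 𝕋) : K.α (K.h v x) = K.μ v (K.α x) := by
  have : K.α ∘ₗ K.h v = K.μ v ∘ₗ K.α := by
    apply ext_W K.span
    intro l
    cases l with
    | nil => simp [h_one, α_one]
    | cons a l => simp [W_cons, h_ι, α_ι]
  exact LinearMap.congr_fun this x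

theorem Rec.twist (hdeg : ∀ p : PW gr, E (W2 p) ∈ gr (pdeg p + 1)) (hf : K.Rec E f)
    (hch : K.dB ∘ₗ f = f ∘ₗ K.dC) : K.Twist E := by
  intro p
  have hα : ∀ x, K.α (f x) = E x := fun x => LinearMap.congr_fun hf.alpha x
  have hε : ∀ x, K.ε (f x) = K.εC x := fun x => LinearMap.congr_fun hf.counit x
  have h1 : f (K.dC (W2 p)) = K.dB (f (W2 p)) := (LinearMap.congr_fun hch _).symm
  rw [← hα (K.dC (W2 p)), h1, dB_f hdeg hf, map_S]
  simp only [map_add, map_neg, map_zsmul, α_ι, α_h, ε_dB, zero_smul, zero_add, hα, hε]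
  rw [S_add, S_neg, S_right p (fun a b => K.εC (W2 b) • K.d (E (W2 a)))]
  · rw [εC_nil, one_smul]; abel
  · intro a b hb; rw [εC_ne _ _ hb, zero_smul]

end Core
end
section
open scoped TensorProduct
variable {R : Type} [CommRing R] (A : DGAlgebra R)

def grN (n : ℤ) : Submodule R A.augIdeal := (A.grading n).comap A.augIdeal.subtype

theorem aug_coe (x : A.augIdeal) : A.aug (x : A.carrier) = 0 := x.2

def pr : A.carrier →ₗ[R] A.augIdeal :=
  LinearMap.codRestrict A.augIdeal
    (LinearMap.id - Algebra.linearMap R A.carrier ∘ₗ A.aug.toLinearMap) (fun a => by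
      simp [DGAlgebra.augIdeal])

theorem pr_coe (a : A.carrier) : (pr A a : A.carrier) = a - algebraMap R A.carrier (A.aug a) := rfl

theorem pr_one : pr A 1 = 0 := by
  apply Subtype.ext; simp [pr_coe]

theorem pr_in (x : A.augIdeal) : pr A (x : A.carrier) = x := by
  apply Subtype.ext; simp [pr_coe, aug_coe]

theorem pr_mem {n : ℤ} {a : A.carrier} (h : a ∈ A.grading n) : pr A a ∈ grN A n := by
  change (pr A a : A.carrier) ∈ A.grading n
  rw [pr_coe]
  refine Submodule.sub_mem _ h ?_
  by_cases hn : n = 0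
  · subst hn
    rw [Algebra.algebraMap_eq_smul_one]
    exact Submodule.smul_mem _ _ A.one_mem
  · rw [A.aug_graded h hn, map_zero]; exact Submodule.zero_mem _

theorem d_one : A.d 1 = 0 := by
  have := A.leibniz (b := 1) A.one_mem
  rw [pm_zero, one_smul, mul_one, one_mul, mul_one] at this
  simpa using this

theorem d_alg (r : R) : A.d (algebraMap R A.carrier r) = 0 := by
  rw [Algebra.algebraMap_eq_smul_one, map_smul, d_one, smul_zero]

theorem kD_pr (a : A.carrier) : A.kD (pr A a) = pr A (A.d a) := by
  apply Subtype.ext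
  change A.d (pr A a : A.carrier) = _
  rw [pr_coe, pr_coe, map_sub, d_alg, A.aug_d, map_zero]

theorem spanA : iSup A.grading = ⊤ := DirectSum.IsInternal.submodule_iSup_eq_top A.grading_internal

theorem spanN : iSup (grN A) = ⊤ := by
  rw [eq_top_iff]
  rintro x -
  have h : (⊤ : Submodule R A.carrier) ≤ (iSup (grN A)).comap (pr A) := by
    rw [← spanA]
    refine iSup_le fun n a ha => ?_
    exact Submodule.mem_iSup_of_mem n (pr_mem A ha)
  have := h (Submodule.mem_top (x := (x : A.carrier)))
  rwa [Submodule.mem_comap, pr_in] at this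

def kMulL : A.augIdeal →ₗ[R] A.augIdeal →ₗ[R] A.augIdeal :=
  LinearMap.mk₂ R A.kMul
    (fun a b c => Subtype.ext (add_mul _ _ _))
    (fun r a b => Subtype.ext (smul_mul_assoc _ _ _))
    (fun a b c => Subtype.ext (mul_add _ _ _))
    (fun r a b => Subtype.ext (mul_smul_comm _ _ _))

variable {A}

def coreA (BD : BarData A) : Core A.grading where
  span := spanA A
  d := A.d
  d_mem := A.d_mem
  μ := LinearMap.mul R A.carrier
  mul_mem := A.mul_mem
  Δ := BD.Δ
  Δ_word := BD.Δ_word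
  dB := BD.dB
  dB_word := BD.dB_word
  sgn := BD.sgnB
  sgn_word := BD.sgnB_word
  tw := BD.tw
  tw_word := BD.tw_word
  α := BD.α
  α_single := BD.α_single
  α_word := BD.α_word
  ε := BD.εB
  ε_one := BD.εB_one
  ε_word := BD.εB_word

def coreN (ND : NBarData A) : Core (grN A) where
  span := spanN A
  d := A.kD
  d_mem := fun h => A.d_mem h
  μ := kMulL A
  mul_mem := fun h h' => A.mul_mem h h'
  Δ := ND.Δn
  Δ_word := ND.Δn_word
  dB := ND.dn
  dB_word := ND.dn_word
  sgn := ND.sgnN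
  sgn_word := ND.sgnN_word
  tw := ND.twN
  tw_word := ND.twN_word
  α := ND.αn
  α_single := ND.αn_single
  α_word := ND.αn_word
  ε := ND.εn
  ε_one := ND.εn_one
  ε_word := ND.εn_word

variable (BD : BarData A) (ND : NBarData A)

theorem coreA_dC : (coreA BD).dC = BD.dBB := rfl
theorem coreA_ΔC : (coreA BD).ΔC = BD.ΔBB := rfl
theorem coreA_εC : (coreA BD).εC = BD.εBB := rfl
theorem coreN_dC : (coreN ND).dC = ND.dnBB := rfl
theorem coreN_ΔC : (coreN ND).ΔC = ND.ΔnBB := rfl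
theorem coreN_εC : (coreN ND).εC = ND.εnBB := rfl

theorem Tgr_le_bar (n : ℤ) : Tgr A.grading n ≤ A.barGrading n := by
  refine Submodule.span_mono ?_
  rintro x ⟨l, h, rfl⟩
  exact ⟨l.map val, l.map Sigma.fst, hom_map l, h, rfl⟩

theorem Tgr_le_nbar (n : ℤ) : Tgr (grN A) n ≤ A.nbarGrading n := by
  refine Submodule.span_mono ?_
  rintro x ⟨l, h, rfl⟩
  exact ⟨l.map val, l.map Sigma.fst, hom_map l, h, rfl⟩

theorem nbar_le_Tgr (n : ℤ) : A.nbarGrading n ≤ Tgr (grN A) n := by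
  refine Submodule.span_mono ?_
  rintro x ⟨l, ds, h, h2, rfl⟩
  obtain ⟨L, rfl, rfl⟩ := exists_lift (gr := grN A) l ds h
  exact ⟨L, h2, rfl⟩

theorem twist_iff (E : A.Bar ⊗[R] A.Bar →ₗ[R] A.carrier) :
    (A.d ∘ₗ E + E ∘ₗ BD.dBB =
    LinearMap.mul' R A.carrier ∘ₗ
      TensorProduct.map (E ∘ₗ TensorProduct.map BD.sgnB BD.sgnB) E ∘ₗ BD.ΔBB) ↔
    (coreA BD).Twist E := by
  have hs : ∀ p : PW A.grading, TensorProduct.map BD.sgnB BD.sgnB (W2 p) = pm (pdeg p) • W2 p := by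
    intro p
    have h1 : BD.sgnB (W p.1) = pm (ldeg p.1) • W p.1 := (coreA BD).sgn_W p.1
    have h2 : BD.sgnB (W p.2) = pm (ldeg p.2) • W p.2 := (coreA BD).sgn_W p.2
    rw [W2, TensorProduct.map_tmul, h1, h2, pdeg, pm_add, TensorProduct.tmul_smul,
      ← TensorProduct.smul_tmul', smul_smul, mul_comm]
  have hr : ∀ p : PW A.grading, (LinearMap.mul' R A.carrier ∘ₗ
      TensorProduct.map (E ∘ₗ TensorProduct.map BD.sgnB BD.sgnB) E ∘ₗ BD.ΔBB) (W2 p) =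
      S p (fun a b => pm (pdeg a) • (coreA BD).μ (E (W2 a)) (E (W2 b))) := by
    intro p
    rw [← coreA_ΔC, LinearMap.comp_apply, LinearMap.comp_apply, Core.ΔC_W2, map_S, map_S]
    refine S_congr p fun a b => ?_
    rw [TensorProduct.map_tmul, LinearMap.comp_apply, hs, LinearMap.mul'_apply, map_zsmul,
      smul_mul_assoc]
    rfl
  constructor
  · intro h p
    rw [← hr, ← h]; rfl
  · intro h
    apply ext_W2 (spanA A)
    intro p
    rw [hr, ← h p]; rfl

/-- normalized letters -/
def prL (a : Lt A.grading) : Lt (grN A) := ⟨a.1, ⟨pr A a.2, pr_mem A a.2.2⟩⟩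
def inL (a : Lt (grN A)) : Lt A.grading := ⟨a.1, ⟨(a.2 : A.augIdeal), a.2.2⟩⟩

theorem val_prL (a : Lt A.grading) : val (prL a) = pr A (val a) := rfl
theorem val_inL (a : Lt (grN A)) : val (inL a) = ((val a : A.augIdeal) : A.carrier) := rfl

theorem ldeg_prL (l : List (Lt A.grading)) : ldeg (l.map prL) = ldeg l := by
  simp only [ldeg, List.map_map]; rfl
theorem ldeg_inL (l : List (Lt (grN A))) : ldeg (l.map inL) = ldeg l := by
  simp only [ldeg, List.map_map]; rfl

def prP (p : PW A.grading) : PW (grN A) := (p.1.map prL, p.2.map prL)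
def inP (p : PW (grN A)) : PW A.grading := (p.1.map inL, p.2.map inL)

theorem pdeg_prP (p : PW A.grading) : pdeg (prP p) = pdeg p := by
  simp [pdeg, prP, ldeg_prL]
theorem pdeg_inP (p : PW (grN A)) : pdeg (inP p) = pdeg p := by
  simp [pdeg, inP, ldeg_inL]

theorem S_prP {M : Type} [AddCommGroup M] (p : PW A.grading) (F : PW (grN A) → PW (grN A) → M) :
    S (prP p) F = S p (fun a b => F (prP a) (prP b)) := by
  simp only [S, prP, ss_map, ldeg_prL]
theorem S_inP {M : Type} [AddCommGroup M] (p : PW (grN A)) (F : PW A.grading → PW A.grading → M) :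
    S (inP p) F = S p (fun a b => F (inP a) (inP b)) := by
  simp only [S, inP, ss_map, ldeg_inL]

variable (A) in
def piA : A.Bar →ₐ[R] A.NBar := TensorAlgebra.lift R (TensorAlgebra.ι R ∘ₗ pr A)

theorem piA_ι (a : A.carrier) : piA A (TensorAlgebra.ι R a) = TensorAlgebra.ι R (pr A a) := by
  simp [piA]

theorem piA_W (l : List (Lt A.grading)) : piA A (W l) = W (l.map prL) := by
  induction l with
  | nil => exact map_one _
  | cons a l ih => rw [W_cons, map_mul, ih, piA_ι, List.map_cons, W_cons, val_prL]

theorem nincl_ι_mul (a : A.augIdeal) (x : A.NBar) : A.nincl (TensorAlgebra.ι R a * x) =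
    TensorAlgebra.ι R (a : A.carrier) * A.nincl x := by
  simp [DGAlgebra.nincl]

theorem nincl_one : A.nincl 1 = 1 := by simp [DGAlgebra.nincl]

theorem nincl_W (l : List (Lt (grN A))) : A.nincl (W l) = W (l.map inL) := by
  induction l with
  | nil => exact nincl_one
  | cons a l ih => rw [W_cons, nincl_ι_mul, ih, List.map_cons, W_cons, val_inL]

theorem nincl_W2 (p : PW (grN A)) : TensorProduct.map A.nincl A.nincl (W2 p) = W2 (inP p) := by
  simp only [W2, TensorProduct.map_tmul, nincl_W, inP]

theorem pi_W2 (p : PW A.grading) :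
    TensorProduct.map (piA A).toLinearMap (piA A).toLinearMap (W2 p) = W2 (prP p) := by
  simp only [W2, TensorProduct.map_tmul, AlgHom.toLinearMap_apply, piA_W, prP]

theorem prL_inL (a : Lt (grN A)) : prL (inL a) = a := by
  obtain ⟨n, a, ha⟩ := a
  simp only [prL, inL, pr_in]

theorem prP_inP (p : PW (grN A)) : prP (inP p) = p := by
  simp only [prP, inP, List.map_map]
  have : (prL ∘ inL : Lt (grN A) → Lt (grN A)) = id := funext prL_inL
  simp [this]

end
section
open scoped TensorProduct
variable {R : Type} [CommRing R] {A : DGAlgebra R}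
variable (BD : BarData A) (ND : NBarData A)

theorem nincl_ε (x : A.NBar) : (coreA BD).ε (A.nincl x) = (coreN ND).ε x := by
  have : (coreA BD).ε ∘ₗ A.nincl = (coreN ND).ε := by
    apply ext_W (spanN A)
    intro l
    cases l with
    | nil => rw [LinearMap.comp_apply, nincl_W]; exact (coreA BD).ε_one.trans (coreN ND).ε_one.symm
    | cons a l => rw [LinearMap.comp_apply, nincl_W, List.map_cons, Core.ε_W_cons, Core.ε_W_cons]
  exact LinearMap.congr_fun this x

theorem nincl_α (x : A.NBar) : (coreA BD).α (A.nincl x) = ((coreN ND).α x : A.augIdeal) := by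
  have : (coreA BD).α ∘ₗ A.nincl = A.augIdeal.subtype ∘ₗ (coreN ND).α := by
    apply ext_W (spanN A)
    intro l
    cases l with
    | nil =>
      rw [LinearMap.comp_apply, LinearMap.comp_apply, nincl_W]
      simp only [List.map_nil, W_nil]
      rw [Core.α_one, Core.α_one, map_zero]
    | cons a l =>
      rw [LinearMap.comp_apply, LinearMap.comp_apply, W_cons, nincl_ι_mul, Core.α_ι, Core.α_ι,
        nincl_ε BD ND, map_smul]
      rfl
  exact LinearMap.congr_fun this x

theorem nincl_h (v : A.augIdeal) (x : A.NBar) :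
    (coreA BD).h (v : A.carrier) (A.nincl x) = A.nincl ((coreN ND).h v x) := by
  have : (coreA BD).h (v : A.carrier) ∘ₗ A.nincl = A.nincl ∘ₗ (coreN ND).h v := by
    apply ext_W (spanN A)
    intro l
    cases l with
    | nil =>
      rw [LinearMap.comp_apply, LinearMap.comp_apply, W_nil, nincl_one, Core.h_one, Core.h_one,
        map_zero]
    | cons a l =>
      rw [LinearMap.comp_apply, LinearMap.comp_apply, W_cons, nincl_ι_mul, Core.h_ι, Core.h_ι,
        nincl_ι_mul]
      rfl
  exact LinearMap.congr_fun this x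

theorem nincl_dB_W (l : List (Lt (grN A))) :
    A.nincl ((coreN ND).dB (W l)) = (coreA BD).dB (W (l.map inL)) := by
  induction l with
  | nil => simp only [List.map_nil, W_nil, Core.dB_one, map_zero]
  | cons a l ih =>
    rw [List.map_cons, W_cons, W_cons, Core.dB_ι _ (val_mem a), Core.dB_ι _ (val_mem (inL a)),
      ← ih, ← nincl_W, val_inL, nincl_h BD ND, map_add, map_neg, map_zsmul, map_add,
      nincl_ι_mul, nincl_ι_mul]
    rfl

theorem nincl_dC (p : PW (grN A)) :
    TensorProduct.map A.nincl A.nincl ((coreN ND).dC (W2 p)) = (coreA BD).dC (W2 (inP p)) := by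
  rw [Core.dC_W2, Core.dC_W2, map_add]
  simp only [inP, ldeg_inL]
  rw [← nincl_dB_W BD ND, ← nincl_dB_W BD ND, ← nincl_W, ← nincl_W]
  congr 1
  exact map_zsmul (TensorProduct.map A.nincl A.nincl) _ _

/-- multiplication from a twisting cochain on the normalized bar construction -/
theorem exists_NMult {E : A.NBar ⊗[R] A.NBar →ₗ[R] A.augIdeal}
    (hdeg : ∀ p : PW (grN A), E (W2 p) ∈ grN A (pdeg p + 1))
    (hl : ∀ b, E (1 ⊗ₜ[R] b) = ND.αn b) (hr : ∀ b, E (b ⊗ₜ[R] 1) = ND.αn b)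
    (ht : (coreN ND).Twist E) : ∃ g : NBarMult ND, (coreN ND).Rec E g.f := by
  have h0 : E (W2 (([], []) : PW (grN A))) = 0 := (hl 1).trans (coreN ND).α_one
  obtain ⟨f, hf⟩ := (coreN ND).exists_Rec h0
  refine ⟨⟨f, hf.one_mul hl, hf.mul_one hr, ?_, hf.chain h0 hdeg ht, hf.counit, hf.coalg h0⟩, hf⟩
  intro l m ds es h1 h2
  obtain ⟨L, rfl, rfl⟩ := exists_lift (gr := grN A) l ds h1
  obtain ⟨M, rfl, rfl⟩ := exists_lift (gr := grN A) m es h2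
  exact Tgr_le_nbar _ (hf.graded h0 hdeg (L, M))

theorem exists_Mult {E : A.Bar ⊗[R] A.Bar →ₗ[R] A.carrier}
    (hdeg : ∀ p : PW A.grading, E (W2 p) ∈ A.grading (pdeg p + 1))
    (hl : ∀ b, E (1 ⊗ₜ[R] b) = BD.α b) (hr : ∀ b, E (b ⊗ₜ[R] 1) = BD.α b)
    (ht : (coreA BD).Twist E) : ∃ g : BarMult BD, (coreA BD).Rec E g.f := by
  have h0 : E (W2 (([], []) : PW A.grading)) = 0 := (hl 1).trans (coreA BD).α_one
  obtain ⟨f, hf⟩ := (coreA BD).exists_Rec h0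
  refine ⟨⟨f, hf.one_mul hl, hf.mul_one hr, ?_, hf.chain h0 hdeg ht, hf.counit, hf.coalg h0⟩, hf⟩
  intro l m ds es h1 h2
  obtain ⟨L, rfl, rfl⟩ := exists_lift (gr := A.grading) l ds h1
  obtain ⟨M, rfl, rfl⟩ := exists_lift (gr := A.grading) m es h2
  exact Tgr_le_bar _ (hf.graded h0 hdeg (L, M))

theorem mem_aug {E : A.Bar ⊗[R] A.Bar →ₗ[R] A.carrier} (hE : IsTwistingCochain BD E)
    (hn : IsNormalized E) (p : PW (grN A)) : E (W2 (inP p)) ∈ A.augIdeal := by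
  have hα : ∀ a : Lt (grN A), BD.α (W [inL a]) ∈ A.augIdeal := by
    intro a
    have : BD.α (W [inL a]) = (val a : A.augIdeal) := BD.α_single _
    rw [this]; exact (val a : A.augIdeal).2
  have h1 : BD.α 1 ∈ A.augIdeal := by
    have : BD.α 1 = 0 := (coreA BD).α_one
    rw [this]; exact Submodule.zero_mem _
  obtain ⟨l, m⟩ := p
  by_cases hlen : 1 < l.length + m.length
  · exact hn.aug_ideal ((l.map inL).map val) ((m.map inL).map val) (by simpa using hlen)
  · match l, m, hlen with
    | [], [], _ => exact (hE.unit_left 1).symm ▸ h1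
    | [a], [], _ => exact (hE.unit_right (W [inL a])).symm ▸ hα a
    | [], [a], _ => exact (hE.unit_left (W [inL a])).symm ▸ hα a
    | _ :: _ :: _, _, h => exact absurd (by simp; omega) h
    | _ :: _, _ :: _, h => exact absurd (by simp; omega) h
    | _, _ :: _ :: _, h => exact absurd (by simp; omega) h

theorem part2 (E : A.Bar ⊗[R] A.Bar →ₗ[R] A.carrier) (hE : IsTwistingCochain BD E)
    (hn : IsNormalized E) :
      ∃! gf : A.NBar ⊗[R] A.NBar →ₗ[R] A.NBar,
        (∃ g : NBarMult ND, g.f = gf) ∧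
        E ∘ₗ TensorProduct.map A.nincl A.nincl =
          A.augIdeal.subtype ∘ₗ ND.αn ∘ₗ gf := by
  have hmem : ∀ x, (E ∘ₗ TensorProduct.map A.nincl A.nincl) x ∈ A.augIdeal := by
    intro x
    have hx : x ∈ Submodule.span R (Set.range (W2 (gr := grN A))) := by
      rw [span_W2 (spanN A)]; exact Submodule.mem_top
    have hle : Submodule.span R (Set.range (W2 (gr := grN A))) ≤
        A.augIdeal.comap (E ∘ₗ TensorProduct.map A.nincl A.nincl) := by
      refine Submodule.span_le.2 ?_
      rintro _ ⟨p, rfl⟩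
      change E (TensorProduct.map A.nincl A.nincl (W2 p)) ∈ A.augIdeal
      rw [nincl_W2]
      exact mem_aug BD hE hn p
    exact hle hx
  obtain ⟨F, hF⟩ : ∃ F : A.NBar ⊗[R] A.NBar →ₗ[R] A.augIdeal,
      E ∘ₗ TensorProduct.map A.nincl A.nincl = A.augIdeal.subtype ∘ₗ F :=
    ⟨LinearMap.codRestrict _ _ hmem, rfl⟩
  have hFx : ∀ x, (F x : A.carrier) = E (TensorProduct.map A.nincl A.nincl x) :=
    fun x => (LinearMap.congr_fun hF x).symm
  have hFp : ∀ p : PW (grN A), (F (W2 p) : A.carrier) = E (W2 (inP p)) :=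
    fun p => by rw [hFx, nincl_W2]
  have hT := (twist_iff BD E).1 hE.twist
  have hdeg : ∀ p : PW (grN A), F (W2 p) ∈ grN A (pdeg p + 1) := by
    intro p
    change (F (W2 p) : A.carrier) ∈ A.grading (pdeg p + 1)
    rw [hFp, ← pdeg_inP]
    exact hE.degree _ _ _ _ (hom_map (inP p).1) (hom_map (inP p).2)
  have hl : ∀ b, F (1 ⊗ₜ[R] b) = ND.αn b := by
    intro b
    apply Subtype.ext
    rw [hFx, TensorProduct.map_tmul, nincl_one, hE.unit_left]
    exact nincl_α BD ND b
  have hr : ∀ b, F (b ⊗ₜ[R] 1) = ND.αn b := by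
    intro b
    apply Subtype.ext
    rw [hFx, TensorProduct.map_tmul, nincl_one, hE.unit_right]
    exact nincl_α BD ND b
  have ht : (coreN ND).Twist F := by
    intro p
    apply A.augIdeal.subtype_injective
    have h := hT (inP p)
    rw [S_inP] at h
    rw [map_add, map_S]
    have e1 : A.augIdeal.subtype ((coreN ND).d (F (W2 p))) = A.d (E (W2 (inP p))) := by
      rw [← hFp]; rfl
    have e2 : A.augIdeal.subtype (F ((coreN ND).dC (W2 p))) = E ((coreA BD).dC (W2 (inP p))) := by
      rw [← nincl_dC BD ND, ← hFx]; rfl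
    rw [e1, e2]
    refine h.trans (S_congr p fun a b => ?_)
    rw [pdeg_inP, map_zsmul, ← hFp, ← hFp]
    rfl
  obtain ⟨g, hg⟩ := exists_NMult ND hdeg hl hr ht
  have h0 : F (W2 (([], []) : PW (grN A))) = 0 := (hl 1).trans (coreN ND).α_one
  refine ⟨g.f, ⟨⟨g, rfl⟩, ?_⟩, ?_⟩
  · have : ND.αn ∘ₗ g.f = F := hg.alpha
    rw [this, hF]
  · rintro gf ⟨⟨g', rfl⟩, h⟩
    have hr' : (coreN ND).Rec (ND.αn ∘ₗ g'.f) g'.f := Core.rec_of_coalg g'.counit g'.coalg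
    have : ND.αn ∘ₗ g'.f = F := by
      apply LinearMap.ext
      intro x
      apply A.augIdeal.subtype_injective
      have h1 := LinearMap.congr_fun (h.symm.trans hF) x
      exact h1
    rw [this] at hr'
    exact hr'.unique h0 hg

end
section
open scoped TensorProduct
variable {R : Type} [CommRing R] {A : DGAlgebra R}
variable (BD : BarData A) (ND : NBarData A)

/-- the augmentation of the letter part -/
def lamL : A.Bar →ₗ[R] R := A.aug.toLinearMap ∘ₗ (coreA BD).α

def lamW (l : List (Lt A.grading)) : R := lamL BD (W l)
def epW (l : List (Lt A.grading)) : R := (coreA BD).ε (W l)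

theorem lamL_ι (v : A.carrier) (x : A.Bar) :
    lamL BD (TensorAlgebra.ι R v * x) = (coreA BD).ε x * A.aug v := by
  simp only [lamL, LinearMap.comp_apply, Core.α_ι, map_smul, AlgHom.toLinearMap_apply, smul_eq_mul]

theorem lamW_nil : lamW BD [] = 0 := by
  simp only [lamW, W_nil, lamL, LinearMap.comp_apply, Core.α_one, map_zero]

theorem epW_nil : epW BD [] = 1 := (coreA BD).ε_one
theorem epW_cons (a : Lt A.grading) (l : List (Lt A.grading)) : epW BD (a :: l) = 0 :=
  (coreA BD).ε_W_cons a l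

theorem lamW_cons (a : Lt A.grading) (l : List (Lt A.grading)) :
    lamW BD (a :: l) = epW BD l * A.aug (val a) := by
  rw [lamW, W_cons, lamL_ι]; rfl

theorem lamW_deg (l : List (Lt A.grading)) (h : lamW BD l ≠ 0) : ldeg l = -1 := by
  match l with
  | [] => exact absurd (lamW_nil BD) h
  | a :: b :: l => rw [lamW_cons, epW_cons, zero_mul] at h; exact absurd rfl h
  | [a] =>
    rw [lamW_cons, epW_nil, one_mul] at h
    have : a.1 = 0 := by
      by_contra hn
      exact h (A.aug_graded (val_mem a) hn)
    rw [ldeg_cons, this]; simp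

theorem lam_z {M : Type} [AddCommGroup M] [Module R M] (l : List (Lt A.grading)) (c c' : ℤ)
    (h : ldeg l = -1 → c = c') (x : M) : c • (lamW BD l • x) = c' • (lamW BD l • x) := by
  by_cases h0 : lamW BD l = 0
  · rw [h0, zero_smul, smul_zero, smul_zero]
  · rw [h (lamW_deg BD l h0)]

theorem pm_neg (n : ℤ) : pm (-n) = pm n := by
  have h := pm_sq n
  have h2 : pm (-n) * pm n = 1 := by rw [← pm_add]; simp [pm_zero]
  calc pm (-n) = pm (-n) * (pm n * pm n) := by rw [h, mul_one]
    _ = (pm (-n) * pm n) * pm n := by ring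
    _ = pm n := by rw [h2, one_mul]

theorem pr_mul (v w : A.carrier) : pr A (v * w) =
    A.kMul (pr A v) (pr A w) + A.aug v • pr A w + A.aug w • pr A v := by
  apply Subtype.ext
  change (pr A (v * w) : A.carrier) = (pr A v : A.carrier) * (pr A w : A.carrier) +
    A.aug v • (pr A w : A.carrier) + A.aug w • (pr A v : A.carrier)
  simp only [pr_coe, map_mul, Algebra.smul_def]
  have := Algebra.commutes (A.aug w) v
  rw [mul_sub, sub_mul, sub_mul, mul_sub, mul_sub, ← this]
  rw [← Algebra.commutes (A.aug w) (algebraMap R A.carrier (A.aug v))]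
  abel

theorem aug_sgn (a : Lt A.grading) {M : Type} [AddCommGroup M] [Module R M] (x : M) :
    pm (a.1 - 1) • (A.aug (val a) • x) = - (A.aug (val a) • x) := by
  by_cases h : a.1 = 0
  · rw [h]; simp [pm_neg_one]
  · rw [A.aug_graded (val_mem a) h]; simp

/-- `P` and `Q` correction terms -/
def PT (l : List (Lt A.grading)) : A.NBar :=
  ss l fun x y => pm (ldeg x) • lamW BD x • W (y.map prL)
def QT (l : List (Lt A.grading)) : A.NBar :=
  ss l fun x y => pm (ldeg x) • lamW BD y • W (x.map prL)

theorem PT_nil : PT BD [] = 0 := by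
  simp [PT, lamW_nil]
theorem QT_nil : QT BD [] = 0 := by
  simp [QT, lamW_nil]

theorem PT_cons (a : Lt A.grading) (l : List (Lt A.grading)) :
    PT BD (a :: l) = - (A.aug (val a) • W (l.map prL)) := by
  rw [PT, ss_cons, lamW_nil, zero_smul, smul_zero, zero_add, ss_left]
  · rw [lamW_cons, epW_nil, one_mul, ldeg_cons, ldeg_nil, add_zero, aug_sgn]
  · intro b x y
    rw [lamW_cons, epW_cons, zero_mul, zero_smul, smul_zero]

theorem QT_cons (a : Lt A.grading) (l : List (Lt A.grading)) :
    QT BD (a :: l) = lamW BD (a :: l) • 1 +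
      pm (a.1 - 1) • (TensorAlgebra.ι R (pr A (val a)) * QT BD l) := by
  have e := map_ss (LinearMap.mulLeft R (TensorAlgebra.ι R (pr A (val a)))) l
    (fun x y => pm (ldeg x) • lamW BD y • W (x.map prL))
  rw [LinearMap.mulLeft_apply] at e
  rw [QT, QT, ss_cons, e, Core.zsmul_ss, ldeg_nil, pm_zero, one_smul, List.map_nil, W_nil]
  congr 1
  refine ss_congr _ fun x y _ => ?_
  rw [LinearMap.mulLeft_apply, ldeg_cons, pm_add, mul_smul, List.map_cons, W_cons, val_prL,
    mul_smul_comm, mul_smul_comm]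

theorem pi_dB (l : List (Lt A.grading)) : piA A ((coreA BD).dB (W l)) =
    (coreN ND).dB (W (l.map prL)) + PT BD l + QT BD l := by
  induction l with
  | nil =>
    simp only [List.map_nil, W_nil, Core.dB_one, map_zero, PT_nil, QT_nil, add_zero]
  | cons a l ih =>
    have hd : pr A ((coreA BD).d (val a)) = (coreN ND).d (pr A (val a)) := (kD_pr A _).symm
    rw [List.map_cons, W_cons, W_cons, Core.dB_ι _ (val_mem a), Core.dB_ι _ (val_mem (prL a)),
      map_add, map_neg, map_mul, map_zsmul, map_add, map_mul, piA_ι, piA_ι, piA_W, ih, val_prL,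
      hd, PT_cons, QT_cons]
    have ha : (prL a).1 = a.1 := rfl
    rw [ha]
    cases l with
    | nil =>
      simp only [List.map_nil, W_nil, Core.h_one, map_zero, PT_nil, QT_nil, add_zero, mul_zero,
        smul_zero, lamW_cons, epW_nil, one_mul]
      abel
    | cons b l =>
      have hh : (coreA BD).h (val a) (W (b :: l)) =
          TensorAlgebra.ι R (val a * val b) * W l := by
        rw [W_cons, Core.h_ι]; rfl
      have hn : (coreN ND).h (pr A (val a)) (W ((b :: l).map prL)) =
          TensorAlgebra.ι R (A.kMul (pr A (val a)) (pr A (val b))) * W (l.map prL) := by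
        rw [List.map_cons, W_cons, Core.h_ι]; rfl
      have hs := aug_sgn a (TensorAlgebra.ι R (pr A (val b)) * W (l.map prL))
      rw [hh, hn, map_mul, piA_ι, piA_W, pr_mul, PT_cons, lamW_cons, epW_cons, zero_mul,
        zero_smul, zero_add, List.map_cons, W_cons, val_prL]
      rw [← hs]
      simp only [map_add, map_smul, mul_add, add_mul, smul_add, mul_neg, smul_neg,
        smul_mul_assoc, mul_smul_comm]
      abel

theorem lam_dB (l : List (Lt A.grading)) : lamL BD ((coreA BD).dB (W l)) =
    ss l fun x y => pm (ldeg x) • lamW BD x • lamW BD y := by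
  cases l with
  | nil => 
    simp only [W_nil, Core.dB_one, map_zero, ss_nil, lamW_nil, zero_smul, smul_zero]
  | cons a l =>
    rw [ss_cons, lamW_nil, zero_smul, smul_zero, zero_add, ss_left]
    · rw [W_cons, Core.dB_ι _ (val_mem a), map_add, map_neg, map_zsmul, map_add, lamL_ι, lamL_ι,
        Core.ε_dB, zero_mul, zero_add, ldeg_cons, ldeg_nil, add_zero, lamW_cons, epW_nil, one_mul]
      have h1 : A.aug ((coreA BD).d (val a)) = 0 := A.aug_d _
      have h2 : lamL BD ((coreA BD).h (val a) (W l)) = A.aug (val a) * lamW BD l := by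
        simp only [lamL, lamW, LinearMap.comp_apply, Core.α_h, AlgHom.toLinearMap_apply]
        exact map_mul A.aug _ _
      rw [h1, h2, mul_zero, neg_zero, zero_add, smul_eq_mul]
    · intro b x y
      rw [lamW_cons, epW_cons, zero_mul, zero_smul, smul_zero]

/-- `Λ` on pairs of words -/
def LamW (p : PW A.grading) : R := lamW BD p.1 * epW BD p.2 + epW BD p.1 * lamW BD p.2

def LamL : A.Bar ⊗[R] A.Bar →ₗ[R] R :=
  (TensorProduct.lid R R).toLinearMap ∘ₗ
    (TensorProduct.map (lamL BD) (coreA BD).ε + TensorProduct.map (coreA BD).ε (lamL BD))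

theorem LamL_tmul (x y : A.Bar) : LamL BD (x ⊗ₜ[R] y) =
    lamL BD x * (coreA BD).ε y + (coreA BD).ε x * lamL BD y := by
  simp [LamL]

theorem LamL_W2 (p : PW A.grading) : LamL BD (W2 p) = LamW BD p := LamL_tmul BD _ _

variable {M : Type} [AddCommGroup M] [Module R M]

theorem epW_ne (l : List (Lt A.grading)) (h : l ≠ []) : epW BD l = 0 := by
  cases l with
  | nil => exact absurd rfl h
  | cons a l => exact epW_cons BD a l

theorem S_Lam_left (l m : List (Lt A.grading)) (G : PW A.grading → PW A.grading → M) :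
    S (l, m) (fun a b => LamW BD a • G a b) =
      ss l (fun x y => lamW BD x • G (x, []) (y, m)) +
      ss m (fun z w => pm (ldeg l * ldeg z) • lamW BD z • G ([], z) (l, w)) := by
  have e1 : S (l, m) (fun a b => (lamW BD a.1 * epW BD a.2) • G a b) =
      ss l (fun x y => lamW BD x • G (x, []) (y, m)) := by
    refine ss_congr _ fun x y _ => ?_
    rw [ss_left]
    · simp [epW_nil, pm_zero]
    · intro a z w; simp [epW_cons]
  have e2 : S (l, m) (fun a b => (epW BD a.1 * lamW BD a.2) • G a b) =
      ss m (fun z w => pm (ldeg l * ldeg z) • lamW BD z • G ([], z) (l, w)) := by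
    rw [S, ss_left]
    · simp [epW_nil]
    · intro a x y; simp [epW_cons, ss_zero]
  rw [← e1, ← e2, ← S_add]
  refine S_congr _ fun a b => ?_
  rw [LamW, add_smul]

theorem S_Lam_right (l m : List (Lt A.grading)) (G : PW A.grading → PW A.grading → M) :
    S (l, m) (fun a b => LamW BD b • G a b) =
      ss l (fun x y => pm (ldeg y * ldeg m) • lamW BD y • G (x, m) (y, [])) +
      ss m (fun z w => lamW BD w • G (l, z) ([], w)) := by
  have e1 : S (l, m) (fun a b => (lamW BD b.1 * epW BD b.2) • G a b) =
      ss l (fun x y => pm (ldeg y * ldeg m) • lamW BD y • G (x, m) (y, [])) := by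
    refine ss_congr _ fun x y _ => ?_
    rw [ss_right]
    · simp [epW_nil]
    · intro a z w; simp [epW_cons]
  have e2 : S (l, m) (fun a b => (epW BD b.1 * lamW BD b.2) • G a b) =
      ss m (fun z w => lamW BD w • G (l, z) ([], w)) := by
    rw [S, ss_right]
    · simp [epW_nil, pm_zero]
    · intro a x y; simp [epW_cons, ss_zero]
  rw [← e1, ← e2, ← S_add]
  refine S_congr _ fun a b => ?_
  rw [LamW, add_smul]
end
section
open scoped TensorProduct
variable {R : Type} [CommRing R] {A : DGAlgebra R}
variable (BD : BarData A) (ND : NBarData A)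
variable {M : Type} [AddCommGroup M] [Module R M]

theorem phi_PT_left (φ : A.NBar ⊗[R] A.NBar →ₗ[R] M) (l m : List (Lt A.grading)) :
    φ (PT BD l ⊗ₜ[R] W (m.map prL)) =
      ss l fun x y => pm (ldeg x) • lamW BD x • φ (W2 (prP (y, m))) := by
  have e := map_ss (φ ∘ₗ (TensorProduct.mk R A.NBar A.NBar).flip (W (m.map prL))) l
    (fun x y => pm (ldeg x) • lamW BD x • W (y.map prL))
  refine Eq.trans e (ss_congr _ fun x y _ => ?_)
  rw [map_zsmul, map_smul]; rfl

theorem phi_QT_left (φ : A.NBar ⊗[R] A.NBar →ₗ[R] M) (l m : List (Lt A.grading)) :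
    φ (QT BD l ⊗ₜ[R] W (m.map prL)) =
      ss l fun x y => pm (ldeg x) • lamW BD y • φ (W2 (prP (x, m))) := by
  have e := map_ss (φ ∘ₗ (TensorProduct.mk R A.NBar A.NBar).flip (W (m.map prL))) l
    (fun x y => pm (ldeg x) • lamW BD y • W (x.map prL))
  refine Eq.trans e (ss_congr _ fun x y _ => ?_)
  rw [map_zsmul, map_smul]; rfl

theorem phi_PT_right (φ : A.NBar ⊗[R] A.NBar →ₗ[R] M) (l m : List (Lt A.grading)) :
    φ (W (l.map prL) ⊗ₜ[R] PT BD m) =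
      ss m fun x y => pm (ldeg x) • lamW BD x • φ (W2 (prP (l, y))) := by
  have e := map_ss (φ ∘ₗ (TensorProduct.mk R A.NBar A.NBar) (W (l.map prL))) m
    (fun x y => pm (ldeg x) • lamW BD x • W (y.map prL))
  refine Eq.trans e (ss_congr _ fun x y _ => ?_)
  rw [map_zsmul, map_smul]; rfl

theorem phi_QT_right (φ : A.NBar ⊗[R] A.NBar →ₗ[R] M) (l m : List (Lt A.grading)) :
    φ (W (l.map prL) ⊗ₜ[R] QT BD m) =
      ss m fun x y => pm (ldeg x) • lamW BD y • φ (W2 (prP (l, x))) := by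
  have e := map_ss (φ ∘ₗ (TensorProduct.mk R A.NBar A.NBar) (W (l.map prL))) m
    (fun x y => pm (ldeg x) • lamW BD y • W (x.map prL))
  refine Eq.trans e (ss_congr _ fun x y _ => ?_)
  rw [map_zsmul, map_smul]; rfl

theorem map_tz (φ : A.NBar ⊗[R] A.NBar →ₗ[R] M) (n : ℤ) (x : A.NBar ⊗[R] A.NBar) :
    φ (n • x) = n • φ x := map_zsmul φ n x

theorem pi_dC (φ : A.NBar ⊗[R] A.NBar →ₗ[R] M) (p : PW A.grading) :
    φ (TensorProduct.map (piA A).toLinearMap (piA A).toLinearMap ((coreA BD).dC (W2 p))) =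
      φ ((coreN ND).dC (W2 (prP p))) +
      S p (fun a b => LamW BD a • pm (pdeg a) • φ (W2 (prP b))) +
      S p (fun a b => LamW BD b • pm (pdeg a) • φ (W2 (prP a))) := by
  obtain ⟨l, m⟩ := p
  have hz : ∀ (n : ℤ) (x : A.Bar ⊗[R] A.Bar),
    φ (TensorProduct.map (piA A).toLinearMap (piA A).toLinearMap (n • x)) =
    n • φ (TensorProduct.map (piA A).toLinearMap (piA A).toLinearMap x) := fun n x =>
      map_zsmul (φ ∘ₗ TensorProduct.map (piA A).toLinearMap (piA A).toLinearMap) n x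
  rw [Core.dC_W2, map_add, map_add, hz, TensorProduct.map_tmul, TensorProduct.map_tmul]
  simp only [AlgHom.toLinearMap_apply]
  rw [pi_dB BD ND, pi_dB BD ND, piA_W, piA_W]
  simp only [TensorProduct.add_tmul, TensorProduct.tmul_add, map_add]
  rw [phi_PT_left, phi_QT_left, phi_PT_right, phi_QT_right]
  rw [Core.dC_W2, map_add, map_tz]
  rw [S_Lam_left, S_Lam_right]
  simp only [smul_add, Core.zsmul_ss]
  have e0 : ldeg (prP (l, m)).1 = ldeg l := ldeg_prL l
  rw [e0]
  have e1 : ss l (fun x y => lamW BD x • pm (pdeg ((x, []) : PW A.grading)) •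
      φ (W2 (prP ((y, m) : PW A.grading)))) =
      ss l fun x y => pm (ldeg x) • lamW BD x • φ (W2 (prP (y, m))) := by
    refine ss_congr _ fun x y _ => ?_
    simp only [pdeg, ldeg_nil, add_zero]
    rw [smul_comm]
  have e2 : ss m (fun z w => pm (ldeg l * ldeg z) • lamW BD z •
      pm (pdeg (([], z) : PW A.grading)) • φ (W2 (prP ((l, w) : PW A.grading)))) =
      ss m fun x y => pm (ldeg l) • pm (ldeg x) • lamW BD x • φ (W2 (prP (l, y))) := by
    refine ss_congr _ fun x y _ => ?_
    rw [smul_comm (lamW BD x), smul_smul, smul_smul]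
    apply lam_z
    intro h
    simp only [pdeg, ldeg_nil, zero_add, h, mul_neg, mul_one, pm_neg]
  have e3 : ss l (fun x y => pm (ldeg y * ldeg m) • lamW BD y •
      pm (pdeg ((x, m) : PW A.grading)) • φ (W2 (prP ((x, m) : PW A.grading)))) =
      ss l fun x y => pm (ldeg x) • lamW BD y • φ (W2 (prP (x, m))) := by
    refine ss_congr _ fun x y _ => ?_
    rw [smul_comm (lamW BD y), smul_smul]
    apply lam_z
    intro h
    simp only [pdeg, h, neg_mul, one_mul, pm_neg, pm_add]
    linear_combination (pm (ldeg x)) * pm_sq (ldeg m)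
  have e4 : ss m (fun z w => lamW BD w •
      pm (pdeg ((l, z) : PW A.grading)) • φ (W2 (prP ((l, z) : PW A.grading)))) =
      ss m fun x y => pm (ldeg l) • pm (ldeg x) • lamW BD y • φ (W2 (prP (l, x))) := by
    refine ss_congr _ fun x y _ => ?_
    rw [smul_comm (lamW BD y), smul_smul]
    simp only [pdeg, pm_add]
  rw [e1, e2, e3, e4]
  simp only [prP]
  abel

theorem Lam_dC (p : PW A.grading) : LamL BD ((coreA BD).dC (W2 p)) =
    S p (fun a b => LamW BD a • pm (pdeg a) • LamW BD b) := by
  obtain ⟨l, m⟩ := p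
  have hz : ∀ (n : ℤ) (x : A.Bar ⊗[R] A.Bar), LamL BD (n • x) = n • LamL BD x := fun n x =>
      map_zsmul (LamL BD) n x
  rw [Core.dC_W2, map_add, hz, LamL_tmul, LamL_tmul, Core.ε_dB, Core.ε_dB, zero_mul, mul_zero,
    add_zero, zero_add, lam_dB, lam_dB, S_Lam_left]
  have e1 : ss l (fun x y => lamW BD x • pm (pdeg ((x, []) : PW A.grading)) •
      LamW BD ((y, m) : PW A.grading)) =
      (ss l fun x y => pm (ldeg x) • lamW BD x • lamW BD y) * epW BD m
        + pm (ldeg l) • lamW BD l • lamW BD m := by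
    have h1 := map_ss (LinearMap.mulRight R (epW BD m)) l
      (fun x y => pm (ldeg x) • lamW BD x • lamW BD y)
    rw [LinearMap.mulRight_apply] at h1
    have h2 := ss_right l (fun x y => pm (ldeg x) • lamW BD x • (epW BD y * lamW BD m))
      (by intro x b y; simp [epW_cons])
    simp only [epW_nil, one_mul] at h2
    rw [h1, ← h2, ← ss_add]
    refine ss_congr _ fun x y _ => ?_
    simp only [LinearMap.mulRight_apply, LamW, pdeg, ldeg_nil, add_zero, smul_mul_assoc]
    rw [smul_comm, smul_add, smul_add]
  have e2 : ss m (fun z w => pm (ldeg l * ldeg z) • lamW BD z •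
      pm (pdeg (([], z) : PW A.grading)) • LamW BD ((l, w) : PW A.grading)) =
      pm (ldeg l) • (epW BD l * ss m fun x y => pm (ldeg x) • lamW BD x • lamW BD y)
        + (pm (ldeg l * ldeg m) * pm (ldeg m)) • lamW BD m • lamW BD l := by
    have h1 := map_ss (LinearMap.mulLeft R (epW BD l)) m
      (fun x y => pm (ldeg x) • lamW BD x • lamW BD y)
    rw [LinearMap.mulLeft_apply] at h1
    have h2 := ss_right m (fun x y => (pm (ldeg l * ldeg x) * pm (ldeg x)) • lamW BD x •
      (lamW BD l * epW BD y)) (by intro x b y; simp [epW_cons])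
    simp only [epW_nil, mul_one] at h2
    rw [h1, ← h2, Core.zsmul_ss, ← ss_add]
    refine ss_congr _ fun x y _ => ?_
    simp only [LinearMap.mulLeft_apply, LamW, pdeg, ldeg_nil, zero_add, mul_smul_comm]
    rw [smul_comm (lamW BD x), smul_add, smul_add, smul_add, smul_smul, smul_smul, smul_smul,
      add_comm]
    congr 1
    apply lam_z
    intro h
    simp only [h, mul_neg, mul_one, pm_neg]
  have e3 : pm (ldeg l) • lamW BD l • lamW BD m +
      (pm (ldeg l * ldeg m) * pm (ldeg m)) • lamW BD m • lamW BD l = 0 := by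
    by_cases hl : lamW BD l = 0
    · simp [hl]
    by_cases hm : lamW BD m = 0
    · simp [hm]
    rw [lamW_deg BD l hl, lamW_deg BD m hm]
    simp [pm_neg_one, pm_one, mul_comm]
  rw [e1, e2]
  change _ * epW BD m + pm (ldeg l) • (epW BD l * _) = _
  rw [← add_zero (_ * epW BD m + _), ← e3]
  abel
end
section
open scoped TensorProduct
variable {R : Type} [CommRing R] {A : DGAlgebra R}
variable (BD : BarData A) (ND : NBarData A)

/-- the extension of a twisting cochain on the normalized bar construction -/
def extE (F : A.NBar ⊗[R] A.NBar →ₗ[R] A.augIdeal) : A.Bar ⊗[R] A.Bar →ₗ[R] A.carrier :=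
  A.augIdeal.subtype ∘ₗ F ∘ₗ TensorProduct.map (piA A).toLinearMap (piA A).toLinearMap +
    Algebra.linearMap R A.carrier ∘ₗ LamL BD

theorem extE_apply (F : A.NBar ⊗[R] A.NBar →ₗ[R] A.augIdeal) (x : A.Bar ⊗[R] A.Bar) :
    extE BD F x = A.augIdeal.subtype
      (F (TensorProduct.map (piA A).toLinearMap (piA A).toLinearMap x)) +
      algebraMap R A.carrier (LamL BD x) := rfl

theorem extE_W2 (F : A.NBar ⊗[R] A.NBar →ₗ[R] A.augIdeal) (p : PW A.grading) :
    extE BD F (W2 p) = A.augIdeal.subtype (F (W2 (prP p))) +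
      algebraMap R A.carrier (LamW BD p) := by
  rw [extE_apply, pi_W2, LamL_W2]

theorem extE_twist (F : A.NBar ⊗[R] A.NBar →ₗ[R] A.augIdeal) (hF : (coreN ND).Twist F) :
    (coreA BD).Twist (extE BD F) := by
  intro p
  have h := congrArg A.augIdeal.subtype (hF (prP p))
  rw [map_add, map_S, S_prP] at h
  have hd : (coreA BD).d (extE BD F (W2 p)) = A.augIdeal.subtype ((coreN ND).d (F (W2 (prP p)))) := by
    rw [extE_W2, map_add]
    have : (coreA BD).d (algebraMap R A.carrier (LamW BD p)) = 0 := d_alg A _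
    rw [this, add_zero]; rfl
  have h1 := pi_dC BD ND (A.augIdeal.subtype ∘ₗ F) p
  simp only [LinearMap.comp_apply] at h1
  have h2 := congrArg (Algebra.linearMap R A.carrier) (Lam_dC BD p)
  rw [map_S] at h2
  rw [hd, extE_apply, h1]
  rw [Algebra.linearMap_apply] at h2
  rw [h2]
  rw [← add_assoc, ← add_assoc, ← add_assoc, h, ← S_add, ← S_add, ← S_add]
  refine S_congr p fun a b => ?_
  rw [extE_W2, extE_W2, pdeg_prP]
  have e1 : A.augIdeal.subtype (pm (pdeg a) • (coreN ND).μ (F (W2 (prP a))) (F (W2 (prP b)))) =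
      pm (pdeg a) • (A.augIdeal.subtype (F (W2 (prP a))) * A.augIdeal.subtype (F (W2 (prP b)))) := by
    rw [map_zsmul]; rfl
  have e2 : ∀ x y : A.carrier, (coreA BD).μ x y = x * y := fun _ _ => rfl
  rw [e1, e2, smul_comm (LamW BD a), smul_comm (LamW BD b), smul_comm (LamW BD a), map_zsmul,
    ← smul_add, ← smul_add, ← smul_add]
  congr 1
  rw [Algebra.linearMap_apply, add_mul, mul_add, mul_add, smul_eq_mul, map_mul, Algebra.smul_def,
    Algebra.smul_def, Algebra.commutes (LamW BD b)]
  abel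

theorem pi_ε (x : A.Bar) : (coreN ND).ε (piA A x) = (coreA BD).ε x := by
  have : (coreN ND).ε ∘ₗ (piA A).toLinearMap = (coreA BD).ε := by
    apply ext_W (spanA A)
    intro l
    rw [LinearMap.comp_apply, AlgHom.toLinearMap_apply, piA_W]
    cases l with
    | nil => exact (coreN ND).ε_one.trans (coreA BD).ε_one.symm
    | cons a l => rw [List.map_cons, Core.ε_W_cons, Core.ε_W_cons]
  exact LinearMap.congr_fun this x

theorem pi_α (x : A.Bar) : (coreN ND).α (piA A x) = pr A ((coreA BD).α x) := by
  have : (coreN ND).α ∘ₗ (piA A).toLinearMap = pr A ∘ₗ (coreA BD).α := by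
    apply ext_W (spanA A)
    intro l
    rw [LinearMap.comp_apply, LinearMap.comp_apply, AlgHom.toLinearMap_apply]
    cases l with
    | nil => rw [W_nil, map_one, Core.α_one, Core.α_one, map_zero]
    | cons a l => rw [W_cons, map_mul, piA_ι, Core.α_ι, Core.α_ι, map_smul, pi_ε BD ND]
  exact LinearMap.congr_fun this x

theorem α_deg (l : List (Lt (grN A))) : (coreN ND).α (W l) ∈ grN A (ldeg l + 1) := by
  match l with
  | [] => rw [W_nil, Core.α_one]; exact Submodule.zero_mem _
  | [a] =>
    rw [W_cons, Core.α_ι, W_nil, Core.ε_one, one_smul, ldeg_cons, ldeg_nil, add_zero,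
      sub_add_cancel]
    exact val_mem a
  | a :: b :: l =>
    rw [W_cons, Core.α_ι, Core.ε_W_cons, zero_smul]; exact Submodule.zero_mem _

theorem α_Tgr {n : ℤ} {x : A.NBar} (hx : x ∈ Tgr (grN A) n) :
    (coreN ND).α x ∈ grN A (n + 1) := by
  have : Tgr (grN A) n ≤ (grN A (n + 1)).comap (coreN ND).α := by
    refine Submodule.span_le.2 ?_
    rintro _ ⟨l, rfl, rfl⟩
    exact α_deg ND l
  exact this hx

theorem LamW_deg (p : PW A.grading) (h : LamW BD p ≠ 0) : pdeg p = -1 := by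
  obtain ⟨l, m⟩ := p
  match l, m with
  | [], m =>
    have : lamW BD m ≠ 0 := by
      intro h0; apply h; simp [LamW, lamW_nil, h0]
    simp [pdeg, lamW_deg BD m this]
  | a :: l, [] =>
    have : lamW BD (a :: l) ≠ 0 := by
      intro h0; apply h; simp [LamW, lamW_nil, h0]
    simp [pdeg, lamW_deg BD _ this]
  | a :: l, b :: m =>
    exfalso; apply h; simp [LamW, epW_cons]

theorem extE_deg (F : A.NBar ⊗[R] A.NBar →ₗ[R] A.augIdeal)
    (hdeg : ∀ p : PW (grN A), F (W2 p) ∈ grN A (pdeg p + 1)) (p : PW A.grading) :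
    extE BD F (W2 p) ∈ A.grading (pdeg p + 1) := by
  rw [extE_W2]
  refine Submodule.add_mem _ ?_ ?_
  · have := hdeg (prP p)
    rw [pdeg_prP] at this
    exact this
  · by_cases h : LamW BD p = 0
    · rw [h, map_zero]; exact Submodule.zero_mem _
    · rw [LamW_deg BD p h, Algebra.algebraMap_eq_smul_one]
      exact Submodule.smul_mem _ _ A.one_mem

theorem lamL_one : lamL BD 1 = 0 := lamW_nil BD

theorem extE_left (F : A.NBar ⊗[R] A.NBar →ₗ[R] A.augIdeal)
    (hl : ∀ b, F (1 ⊗ₜ[R] b) = ND.αn b) (b : A.Bar) : extE BD F (1 ⊗ₜ[R] b) = BD.α b := by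
  rw [extE_apply, TensorProduct.map_tmul, LamL_tmul, lamL_one, (coreA BD).ε_one, zero_mul, one_mul,
    zero_add]
  simp only [AlgHom.toLinearMap_apply, map_one, hl]
  have h1 : ND.αn (piA A b) = pr A (BD.α b) := pi_α BD ND b
  rw [h1]
  change (pr A (BD.α b) : A.carrier) + algebraMap R A.carrier (A.aug (BD.α b)) = _
  rw [pr_coe, sub_add_cancel]

theorem extE_right (F : A.NBar ⊗[R] A.NBar →ₗ[R] A.augIdeal)
    (hr : ∀ b, F (b ⊗ₜ[R] 1) = ND.αn b) (b : A.Bar) : extE BD F (b ⊗ₜ[R] 1) = BD.α b := by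
  rw [extE_apply, TensorProduct.map_tmul, LamL_tmul, lamL_one, (coreA BD).ε_one, mul_zero, mul_one,
    add_zero]
  simp only [AlgHom.toLinearMap_apply, map_one, hr]
  have h1 : ND.αn (piA A b) = pr A (BD.α b) := pi_α BD ND b
  rw [h1]
  change (pr A (BD.α b) : A.carrier) + algebraMap R A.carrier (A.aug (BD.α b)) = _
  rw [pr_coe, sub_add_cancel]

theorem piA_word (l : List A.carrier) (h : (1 : A.carrier) ∈ l) : piA A (A.word l) = 0 := by
  obtain ⟨s, t, rfl⟩ := List.append_of_mem h
  simp [DGAlgebra.word, piA_ι, pr_one]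

theorem Lam_word (l m : List A.carrier) (h : 1 < l.length + m.length) :
    LamL BD (A.word l ⊗ₜ[R] A.word m) = 0 := by
  have hα : ∀ k : List A.carrier, k.length ≠ 1 → lamL BD (A.word k) = 0 := by
    intro k hk
    have : (coreA BD).α (A.word k) = 0 := BD.α_word k hk
    rw [lamL, LinearMap.comp_apply, this, map_zero]
  have hε : ∀ k : List A.carrier, k.length ≠ 0 → (coreA BD).ε (A.word k) = 0 := by
    intro k hk
    exact BD.εB_word k (fun h => hk (by simp [h]))
  rw [LamL_tmul]
  have e1 : lamL BD (A.word l) * (coreA BD).ε (A.word m) = 0 := by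
    by_cases hm : m.length = 0
    · rw [hα l (by omega), zero_mul]
    · rw [hε m hm, mul_zero]
  have e2 : (coreA BD).ε (A.word l) * lamL BD (A.word m) = 0 := by
    by_cases hl : l.length = 0
    · rw [hα m (by omega), mul_zero]
    · rw [hε l hl, zero_mul]
  rw [e1, e2, add_zero]

theorem extE_norm (F : A.NBar ⊗[R] A.NBar →ₗ[R] A.augIdeal)
    (hl : ∀ b, F (1 ⊗ₜ[R] b) = ND.αn b) (hr : ∀ b, F (b ⊗ₜ[R] 1) = ND.αn b) :
    IsNormalized (extE BD F) where
  one_right := (extE_right BD ND F hr _).trans (BD.α_single 1)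
  one_left := (extE_left BD ND F hl _).trans (BD.α_single 1)
  vanish := by
    intro l m hlm h
    rw [extE_apply, Lam_word BD l m hlm, map_zero, add_zero, TensorProduct.map_tmul]
    simp only [AlgHom.toLinearMap_apply]
    rcases h with h | h
    · rw [piA_word l h, TensorProduct.zero_tmul, map_zero, map_zero]
    · rw [piA_word m h, TensorProduct.tmul_zero, map_zero, map_zero]
  aug_ideal := by
    intro l m hlm
    rw [extE_apply, Lam_word BD l m hlm, map_zero, add_zero]
    exact aug_coe A _

theorem lamW_inL (l : List (Lt (grN A))) : lamW BD (l.map inL) = 0 := by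
  cases l with
  | nil => exact lamW_nil BD
  | cons a l => rw [List.map_cons, lamW_cons, val_inL, aug_coe, mul_zero]

theorem extE_inP (F : A.NBar ⊗[R] A.NBar →ₗ[R] A.augIdeal) (p : PW (grN A)) :
    extE BD F (W2 (inP p)) = (F (W2 p) : A.augIdeal) := by
  rw [extE_W2, prP_inP]
  have : LamW BD (inP p) = 0 := by simp [LamW, inP, lamW_inL]
  rw [this, map_zero, add_zero]; rfl

theorem εC_inP (p : PW (grN A)) : (coreA BD).εC (W2 (inP p)) = (coreN ND).εC (W2 p) := by
  simp only [W2, Core.εC, LinearMap.comp_apply, TensorProduct.map_tmul, inP, ← nincl_W,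
    nincl_ε BD ND]

theorem part1 (g : NBarMult ND) : ∃ fm : BarMult BD,
      IsTwistingCochain BD (BD.α ∘ₗ fm.f) ∧
      IsNormalized (BD.α ∘ₗ fm.f) ∧
      fm.f ∘ₗ TensorProduct.map A.nincl A.nincl = A.nincl ∘ₗ g.f := by
  have hrec : (coreN ND).Rec (ND.αn ∘ₗ g.f) g.f := Core.rec_of_coalg g.counit g.coalg
  have hdegN : ∀ p : PW (grN A), (ND.αn ∘ₗ g.f) (W2 p) ∈ grN A (pdeg p + 1) := by
    intro p
    exact α_Tgr ND (nbar_le_Tgr _ (g.graded _ _ _ _ (hom_map p.1) (hom_map p.2)))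
  have htN := hrec.twist hdegN g.chain
  have hl : ∀ b, (ND.αn ∘ₗ g.f) (1 ⊗ₜ[R] b) = ND.αn b := fun b => by
    rw [LinearMap.comp_apply, g.one_mul]
  have hr : ∀ b, (ND.αn ∘ₗ g.f) (b ⊗ₜ[R] 1) = ND.αn b := fun b => by
    rw [LinearMap.comp_apply, g.mul_one]
  generalize ND.αn ∘ₗ g.f = F at *
  have hdeg := extE_deg BD F hdegN
  have hEl := extE_left BD ND F hl
  have hEr := extE_right BD ND F hr
  have hT := extE_twist BD ND F htN
  obtain ⟨fm, hfm⟩ := exists_Mult BD hdeg hEl hEr hT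
  have hα : BD.α ∘ₗ fm.f = extE BD F := hfm.alpha
  refine ⟨fm, ?_, ?_, ?_⟩
  · rw [hα]
    refine ⟨?_, hEl, hEr, (twist_iff BD _).2 hT⟩
    intro l m ds es h1 h2
    obtain ⟨L, rfl, rfl⟩ := exists_lift (gr := A.grading) l ds h1
    obtain ⟨M, rfl, rfl⟩ := exists_lift (gr := A.grading) m es h2
    exact hdeg (L, M)
  · rw [hα]; exact extE_norm BD ND F hl hr
  · apply ext_W2 (spanN A)
    intro p
    rw [LinearMap.comp_apply, LinearMap.comp_apply, nincl_W2]
    induction p using Core.plen_induction with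
    | H p ih =>
      rw [hfm.apply, hrec.apply, map_add, map_S, S_inP, εC_inP BD ND]
      congr 1
      · simp [DGAlgebra.nincl]
      · have h0 : F (W2 (([], []) : PW (grN A))) = 0 := (hl 1).trans (coreN ND).α_one
        apply S_rec
        · intro b
          rw [extE_inP, h0]; simp
        · intro a b hb _
          rw [extE_inP, nincl_ι_mul, ih b hb]
end

end NBH

/-- For an augmented unital associative dg algebra `A` over `R` with
augmentation ideal `Ā`:
(1) every multiplication on the normalized bar construction `B̄A` (a morphism of dg
coalgebras with `𝟙` as two-sided unit) extends canonically to a multiplication on `BA`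
whose twisting cochain `E = α ∘ f` is normalized — the extension restricting to the
given multiplication along the canonical inclusion `B̄A → BA`; and
(2) every normalized twisting cochain `E : BA ⊗ BA → A` comes from a unique
multiplication on `B̄A`.  Thus normalized twisting cochains correspond bijectively to
multiplications on `B̄A`. -/
theorem normalized_twistingCochain_correspondence {R : Type} [CommRing R]
    (A : DGAlgebra R) (BD : BarData A) (ND : NBarData A) :
    -- (1) extension of a multiplication on B̄A to BA with normalized twisting cochain
    (∀ g : NBarMult ND, ∃ fm : BarMult BD,
      IsTwistingCochain BD (BD.α ∘ₗ fm.f) ∧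
      IsNormalized (BD.α ∘ₗ fm.f) ∧
      fm.f ∘ₗ TensorProduct.map A.nincl A.nincl = A.nincl ∘ₗ g.f) ∧
    -- (2) every normalized twisting cochain comes from a unique multiplication on B̄A
    (∀ E : A.Bar ⊗[R] A.Bar →ₗ[R] A.carrier, IsTwistingCochain BD E → IsNormalized E →
      ∃! gf : A.NBar ⊗[R] A.NBar →ₗ[R] A.NBar,
        (∃ g : NBarMult ND, g.f = gf) ∧
        E ∘ₗ TensorProduct.map A.nincl A.nincl =
          A.augIdeal.subtype ∘ₗ ND.αn ∘ₗ gf) := by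
  exact ⟨fun g => NBH.part1 BD ND g, fun E hE hn => NBH.part2 BD ND E hE hn⟩
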